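/- arXiv:2308.11571 — 5 statements merged into one kernel-verified Lean document; each statement's English description precedes it below -/
import Mathlib

section
/- Let V be a complex vector space and let k be a positive integer. Then the k-th tensor power V^{⊗k} is the internal direct sum of the subspaces W_λ(V) as λ ranges over all partitions of k; that is, every tensor in V^{⊗k} can be written uniquely as a sum of one element from each W_λ(V). -/
open TensorAlgebra

variable (V : Type*) [AddCommGroup V] [Module ℂ V]

/-- `IsLieElem V i x` says that `x ∈ V^{⊗i}` is an iterated commutator of `i`
elements of `V` inside the tensor algebra, where `[a,b] = a⊗b − b⊗a`. -/
inductive IsLieElem : ℕ → TensorAlgebra ℂ V → Prop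
  | base (v : V) : IsLieElem 1 (ι ℂ v)
  | bracket {a b : ℕ} {x y : TensorAlgebra ℂ V} :
      IsLieElem a x → IsLieElem b y → IsLieElem (a + b) (x * y - y * x)

/-- `Lie^i V`: the `i`-th homogeneous component of the free Lie algebra on `V`,
i.e. the linear span of all iterated commutators of `i` elements of `V`. -/
noncomputable def lieGrade (i : ℕ) : Submodule ℂ (TensorAlgebra ℂ V) :=
  Submodule.span ℂ {x | IsLieElem V i x}

/-- `Σ_{α ∈ P(λ)} T_{α₁} ⊗ ⋯ ⊗ T_{α_ℓ}`: the sum over all distinct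
permutations of the multiset `lam`. -/
noncomputable def thrallElt (T : ℕ → TensorAlgebra ℂ V) (lam : Multiset ℕ) :
    TensorAlgebra ℂ V :=
  (lam.toList.permutations.dedup.map fun L => (L.map T).prod).sum

/-- The Thrall module `W_λ(V) ⊆ V^{⊗k}`. -/
noncomputable def thrallModule {k : ℕ} (lam : Nat.Partition k) :
    Submodule ℂ (TensorAlgebra ℂ V) :=
  Submodule.span ℂ
    {x | ∃ T : ℕ → TensorAlgebra ℂ V, (∀ i, T i ∈ lieGrade V i) ∧ x = thrallElt V T lam.parts}

/-- The degree-`k` component `V^{⊗k}` of the tensor algebra: the span of the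
elementary tensors `v₁ ⊗ ⋯ ⊗ v_k`. -/
noncomputable def gradeTA (k : ℕ) : Submodule ℂ (TensorAlgebra ℂ V) :=
  Submodule.span ℂ {x | ∃ v : Fin k → V, x = (List.ofFn fun i => ι ℂ (v i)).prod}

open scoped TensorProduct

namespace Thrall

/-- Coproduct. -/
noncomputable def comul : TensorAlgebra ℂ V →ₐ[ℂ] TensorAlgebra ℂ V ⊗[ℂ] TensorAlgebra ℂ V :=
  TensorAlgebra.lift ℂ
    ((TensorProduct.mk ℂ _ _).flip 1 ∘ₗ ι ℂ + (TensorProduct.mk ℂ _ _) 1 ∘ₗ ι ℂ)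

theorem comul_ι (v : V) : comul V (ι ℂ v) = ι ℂ v ⊗ₜ 1 + 1 ⊗ₜ ι ℂ v := by
  simp [comul]

theorem comul_isLie {n : ℕ} {x : TensorAlgebra ℂ V} (h : IsLieElem V n x) :
    comul V x = x ⊗ₜ 1 + 1 ⊗ₜ x := by
  induction h with
  | base v => exact comul_ι V v
  | bracket hx hy ihx ihy =>
    rw [map_sub, map_mul, map_mul, ihx, ihy]
    simp only [mul_add, add_mul, Algebra.TensorProduct.tmul_mul_tmul, mul_one, one_mul,
      TensorProduct.sub_tmul, TensorProduct.tmul_sub]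
    abel

theorem comul_lieGrade {n : ℕ} {x : TensorAlgebra ℂ V} (h : x ∈ lieGrade V n) :
    comul V x = x ⊗ₜ 1 + 1 ⊗ₜ x := by
  induction h using Submodule.span_induction with
  | mem x hx => exact comul_isLie V hx
  | zero => simp
  | add x y _ _ hx hy =>
    rw [map_add, hx, hy, TensorProduct.add_tmul, TensorProduct.tmul_add]; abel
  | smul c x _ hx =>
    rw [map_smul, hx, smul_add, TensorProduct.smul_tmul', TensorProduct.tmul_smul]

theorem isLie_mem {n : ℕ} {x : TensorAlgebra ℂ V} (h : IsLieElem V n x) :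
    x ∈ (LinearMap.range (ι ℂ (M := V))) ^ n := by
  induction h with
  | base v => rw [pow_one]; exact ⟨v, rfl⟩
  | @bracket a b x y hx hy ihx ihy =>
    refine Submodule.sub_mem _ ?_ ?_
    · rw [pow_add]; exact Submodule.mul_mem_mul ihx ihy
    · rw [add_comm, pow_add]; exact Submodule.mul_mem_mul ihy ihx

theorem lieGrade_le (n : ℕ) : lieGrade V n ≤ (LinearMap.range (ι ℂ (M := V))) ^ n :=
  Submodule.span_le.2 fun _ h => isLie_mem V h

/-- Projection to degree `a`. -/
noncomputable def pr (a : ℕ) : TensorAlgebra ℂ V →ₗ[ℂ] TensorAlgebra ℂ V :=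
  GradedAlgebra.proj ((LinearMap.range (ι ℂ (M := V))) ^ · : ℕ → Submodule ℂ _) a

theorem pr_lie (a b : ℕ) {x : TensorAlgebra ℂ V} (h : x ∈ lieGrade V b) :
    pr V a x = if b = a then x else 0 := by
  have h' := lieGrade_le V b h
  rw [pr, GradedAlgebra.proj_apply]
  split_ifs with hab
  · subst hab
    exact DirectSum.decompose_of_mem_same
      ((LinearMap.range (ι ℂ (M := V))) ^ · : ℕ → Submodule ℂ _) h'
  · exact DirectSum.decompose_of_mem_ne
      ((LinearMap.range (ι ℂ (M := V))) ^ · : ℕ → Submodule ℂ _) h' hab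

theorem pr_one (a : ℕ) (ha : 0 < a) : pr V a 1 = 0 := by
  rw [pr, GradedAlgebra.proj_apply]
  exact DirectSum.decompose_of_mem_ne
      ((LinearMap.range (ι ℂ (M := V))) ^ · : ℕ → Submodule ℂ _) (i := 0)
      (by rw [pow_zero]; exact Submodule.one_le.1 le_rfl) ha.ne

/-- All ways of splitting a list into a subsequence and its complement. -/
def splits : List ℕ → List (List ℕ × List ℕ)
  | [] => [([], [])]
  | b :: l => ((splits l).map fun p => (b :: p.1, p.2)) ++ ((splits l).map fun p => (p.1, b :: p.2))

theorem splits_perm : ∀ (l : List ℕ) (p), p ∈ splits l → (p.1 ++ p.2).Perm l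
  | [], p, h => by simp [splits] at h; subst h; simp
  | b :: l, p, h => by
    simp only [splits, List.mem_append, List.mem_map] at h
    rcases h with ⟨q, hq, rfl⟩ | ⟨q, hq, rfl⟩
    · exact (splits_perm l q hq).cons b
    · exact List.perm_middle.trans ((splits_perm l q hq).cons b)

theorem nil_mem_splits : ∀ l : List ℕ, ([], l) ∈ splits l
  | [] => by simp [splits]
  | b :: l => by
    simp only [splits, List.mem_append, List.mem_map]
    exact Or.inr ⟨_, nil_mem_splits l, rfl⟩

theorem comul_prod (T : ℕ → TensorAlgebra ℂ V) (hT : ∀ i, T i ∈ lieGrade V i) :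
    ∀ l : List ℕ, comul V (l.map T).prod =
      ((splits l).map fun p => (p.1.map T).prod ⊗ₜ[ℂ] (p.2.map T).prod).sum
  | [] => by simp [splits]; rfl
  | b :: l => by
    rw [List.map_cons, List.prod_cons, map_mul, comul_lieGrade V (hT b), comul_prod T hT l]
    simp only [splits, List.map_append, List.map_map, List.sum_append, add_mul,
      ← List.sum_map_mul_left]
    simp [Function.comp_def]

/-- Convolution of degree projections. -/
noncomputable def conv : List ℕ → (TensorAlgebra ℂ V →ₗ[ℂ] TensorAlgebra ℂ V)
  | [] => LinearMap.id
  | a :: l => LinearMap.mul' ℂ _ ∘ₗ TensorProduct.map (pr V a) (conv l) ∘ₗ (comul V).toLinearMap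

theorem conv_cons (T : ℕ → TensorAlgebra ℂ V) (hT : ∀ i, T i ∈ lieGrade V i) (a : ℕ)
    (α β : List ℕ) : conv V (a :: α) (β.map T).prod =
      ((splits β).map fun p => pr V a (p.1.map T).prod * conv V α (p.2.map T).prod).sum := by
  simp only [conv, LinearMap.comp_apply, AlgHom.toLinearMap_apply]
  rw [comul_prod V T hT, map_list_sum, map_list_sum]
  simp [Function.comp_def]

theorem sum_eq_zero' {ι M : Type*} [AddCommMonoid M] (l : List ι) (f : ι → M)
    (h : ∀ i ∈ l, f i = 0) : (l.map f).sum = 0 := by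
  rw [List.map_congr_left h]; simp

theorem conv_short (T : ℕ → TensorAlgebra ℂ V) (hT : ∀ i, T i ∈ lieGrade V i) :
    ∀ (α β : List ℕ), (∀ a ∈ α, 0 < a) → β.length < α.length → conv V α (β.map T).prod = 0
  | [], β, _, h => by simp at h
  | a :: α, β, hp, h => by
    rw [conv_cons V T hT]
    refine sum_eq_zero' _ _ ?_
    rintro ⟨A, B⟩ hAB
    have hl := (splits_perm _ _ hAB).length_eq
    simp only [List.length_append, List.length_cons] at hl h
    rcases A with _ | ⟨b, A⟩
    · simp [pr_one V a (hp a (by simp))]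
    · simp only [List.length_cons] at hl
      rw [conv_short T hT α B (fun x hx => hp x (by simp [hx])) (by omega), mul_zero]

/-- The multiplicity. -/
def mult : List ℕ → List ℕ → ℕ
  | [], _ => 1
  | a :: α, β => ((splits β).map fun p => if p.1 = [a] then mult α p.2 else 0).sum

theorem mult_self : ∀ α, 0 < mult α α
  | [] => by simp [mult]
  | a :: α => by
    have h : ([a], α) ∈ splits (a :: α) := by
      simp only [splits, List.mem_append, List.mem_map]
      exact Or.inl ⟨_, nil_mem_splits α, rfl⟩
    have := List.single_le_sum (l := ((splits (a :: α)).map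
      fun p => if p.1 = [a] then mult α p.2 else 0)) (by simp) _ (List.mem_map_of_mem h)
    simp only [if_true] at this
    exact lt_of_lt_of_le (mult_self α) this

theorem mult_perm : ∀ α β : List ℕ, β.length ≤ α.length → mult α β ≠ 0 → α.Perm β
  | [], β, h, _ => by simp at h; simp [h]
  | a :: α, β, h, h0 => by
    by_contra hn
    apply h0
    refine sum_eq_zero' _ _ ?_
    rintro ⟨A, B⟩ hAB
    have hl := splits_perm _ _ hAB
    by_cases hA : A = [a]
    · subst hA
      have hle := hl.length_eq
      simp only [List.length_append, List.length_cons, List.length_nil] at hle h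
      simp only [if_true]
      by_contra h1
      exact hn (((mult_perm α B (by omega) h1).cons a).trans hl)
    · simp [hA]

theorem conv_eq (T : ℕ → TensorAlgebra ℂ V) (hT : ∀ i, T i ∈ lieGrade V i) :
    ∀ (α β : List ℕ), (∀ a ∈ α, 0 < a) → β.length ≤ α.length →
      conv V α (β.map T).prod = (mult α β : ℂ) • (α.map T).prod
  | [], β, _, h => by simp at h; simp [h, conv, mult]
  | a :: α, β, hp, h => by
    rw [conv_cons V T hT, mult, Nat.cast_list_sum, List.sum_smul, List.map_map, List.map_map]
    refine congrArg List.sum (List.map_congr_left ?_)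
    rintro ⟨A, B⟩ hAB
    have hl := (splits_perm _ _ hAB).length_eq
    simp only [List.length_append, List.length_cons] at hl h
    have hp' : ∀ x ∈ α, 0 < x := fun x hx => hp x (by simp [hx])
    rcases A with _ | ⟨b, _ | ⟨c, A⟩⟩
    · simp [pr_one V a (hp a (by simp))]
    · simp only [List.length_cons, List.length_nil] at hl
      simp only [List.map_cons, List.map_nil, List.prod_cons, List.prod_nil, mul_one]
      rw [pr_lie V a b (hT b), conv_eq T hT α B hp' (by omega)]
      by_cases hab : b = a
      · subst hab; simp
      · simp [hab]
    · simp only [List.length_cons] at hl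
      rw [conv_short V T hT α B hp' (by omega)]
      simp

/-- distinct rearrangements -/
noncomputable def P (lam : Multiset ℕ) : Finset (List ℕ) := lam.toList.permutations.toFinset

theorem mem_P {lam : Multiset ℕ} {L : List ℕ} : L ∈ P lam ↔ (L : Multiset ℕ) = lam := by
  rw [P, List.mem_toFinset, List.mem_permutations, ← Multiset.coe_eq_coe, Multiset.coe_toList]

theorem thrallElt_eq (T : ℕ → TensorAlgebra ℂ V) (lam : Multiset ℕ) :
    thrallElt V T lam = ∑ L ∈ P lam, (L.map T).prod := by
  rw [thrallElt, P, ← List.sum_toFinset _ (List.nodup_dedup _)]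
  congr 1
  ext; simp

noncomputable def cst (α : List ℕ) : ℕ := ∑ β ∈ P (α : Multiset ℕ), mult α β

theorem cst_ne (α : List ℕ) : cst α ≠ 0 := by
  have : mult α α ≤ cst α :=
    Finset.single_le_sum (f := fun β => mult α β) (fun _ _ => Nat.zero_le _) (mem_P.2 rfl)
  have := mult_self α
  omega

noncomputable def E (lam : Multiset ℕ) : TensorAlgebra ℂ V →ₗ[ℂ] TensorAlgebra ℂ V :=
  ∑ α ∈ P lam, ((cst α : ℂ)⁻¹) • conv V α

theorem E_self (T : ℕ → TensorAlgebra ℂ V) (hT : ∀ i, T i ∈ lieGrade V i) (lam : Multiset ℕ)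
    (hp : ∀ a ∈ lam, 0 < a) : E V lam (thrallElt V T lam) = thrallElt V T lam := by
  rw [thrallElt_eq, E, LinearMap.sum_apply]
  refine Finset.sum_congr rfl fun α hα => ?_
  have hα' := mem_P.1 hα
  rw [LinearMap.smul_apply, map_sum]
  have : ∀ β ∈ P lam, conv V α (β.map T).prod = (mult α β : ℂ) • (α.map T).prod := by
    intro β hβ
    refine conv_eq V T hT α β (fun a ha => hp a (by rw [← hα']; exact ha)) ?_
    have := mem_P.1 hβ
    rw [← hα', Multiset.coe_eq_coe] at this
    exact this.length_eq.le
  rw [Finset.sum_congr rfl this, ← Finset.sum_smul, smul_smul, ← Nat.cast_sum]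
  have h2 : ∑ β ∈ P lam, mult α β = cst α := by rw [cst, hα']
  rw [h2, inv_mul_cancel₀ (by exact_mod_cast cst_ne α), one_smul]

theorem E_ne (T : ℕ → TensorAlgebra ℂ V) (hT : ∀ i, T i ∈ lieGrade V i) (lam mu : Multiset ℕ)
    (hp : ∀ a ∈ lam, 0 < a) (hne : mu ≠ lam) (hc : mu.card ≤ lam.card) :
    E V lam (thrallElt V T mu) = 0 := by
  rw [thrallElt_eq, E, LinearMap.sum_apply]
  refine Finset.sum_eq_zero fun α hα => ?_
  have hα' := mem_P.1 hα
  rw [LinearMap.smul_apply, map_sum, Finset.sum_eq_zero, smul_zero]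
  intro β hβ
  have hβ' := mem_P.1 hβ
  have hlen : β.length ≤ α.length := by
    rw [← hα', ← hβ'] at hc; simpa using hc
  rw [conv_eq V T hT α β (fun a ha => hp a (by rw [← hα']; exact ha)) hlen]
  have : mult α β = 0 := by
    by_contra h
    apply hne
    rw [← hα', ← hβ', Multiset.coe_eq_coe]
    exact (mult_perm α β hlen h).symm
  simp [this]

theorem E_mem_self {k : ℕ} (lam : Nat.Partition k) {x} (hx : x ∈ thrallModule V lam) :
    E V lam.parts x = x := by
  induction hx using Submodule.span_induction with
  | mem x hx =>
    obtain ⟨T, hT, rfl⟩ := hx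
    exact E_self V T hT _ fun a ha => lam.parts_pos ha
  | zero => simp
  | add x y _ _ hx hy => rw [map_add, hx, hy]
  | smul c x _ hx => rw [map_smul, hx]

theorem E_mem_ne {k : ℕ} (lam mu : Nat.Partition k) (hne : mu ≠ lam)
    (hc : mu.parts.card ≤ lam.parts.card) {x} (hx : x ∈ thrallModule V mu) :
    E V lam.parts x = 0 := by
  induction hx using Submodule.span_induction with
  | mem x hx =>
    obtain ⟨T, hT, rfl⟩ := hx
    exact E_ne V T hT _ _ (fun a ha => lam.parts_pos ha) (fun h => hne (Nat.Partition.ext h)) hc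
  | zero => simp
  | add x y _ _ hx hy => rw [map_add, hx, hy, add_zero]
  | smul c x _ hx => rw [map_smul, hx, smul_zero]

theorem indep {k : ℕ} (e : Nat.Partition k → TensorAlgebra ℂ V)
    (he : ∀ lam, e lam ∈ thrallModule V lam) (hs : ∑ lam, e lam = 0) : ∀ lam, e lam = 0 := by
  have key : ∀ n : ℕ, ∀ lam : Nat.Partition k, k - lam.parts.card = n → e lam = 0 := by
    intro n
    induction n using Nat.strong_induction_on with
    | _ n ih =>
      intro lam hn
      have h := congrArg (E V lam.parts) hs
      rw [map_sum, map_zero, Finset.sum_eq_single lam, E_mem_self V lam (he lam)] at h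
      · exact h
      · intro mu _ hne
        by_cases hc : mu.parts.card ≤ lam.parts.card
        · exact E_mem_ne V lam mu hne hc (he mu)
        · have hb : mu.parts.card ≤ k := by
            have := Multiset.card_nsmul_le_sum (s := mu.parts) (a := 1)
              (fun x hx => mu.parts_pos hx)
            rw [mu.parts_sum] at this
            simpa using this
          rw [ih (k - mu.parts.card) (by omega) mu rfl, map_zero]
      · simp
  exact fun lam => key _ lam rfl

/-- Polarized family. -/
noncomputable def polT {n : ℕ} (d : Fin n → ℕ) (x : Fin n → TensorAlgebra ℂ V)
    (U : Finset (Fin n)) (i : ℕ) : TensorAlgebra ℂ V :=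
  ∑ j ∈ Finset.univ.filter (fun j => j ∉ U ∧ d j = i), x j

theorem polT_mem {n : ℕ} (d : Fin n → ℕ) (x : Fin n → TensorAlgebra ℂ V)
    (hx : ∀ j, x j ∈ lieGrade V (d j)) (U : Finset (Fin n)) (i : ℕ) :
    polT V d x U i ∈ lieGrade V i := by
  refine Submodule.sum_mem _ fun j hj => ?_
  have := (Finset.mem_filter.1 hj).2.2
  rw [← this]
  exact hx j

theorem polT_prod {n : ℕ} (d : Fin n → ℕ) (x : Fin n → TensorAlgebra ℂ V)
    (U : Finset (Fin n)) (L : List ℕ) (hL : L.length = n) :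
    (L.map (polT V d x U)).prod =
      ∑ r : Fin n → Fin n, if (∀ p, r p ∉ U) ∧ List.ofFn (d ∘ r) = L then
        (List.ofFn (x ∘ r)).prod else 0 := by
  obtain ⟨g, rfl⟩ : ∃ g : Fin n → ℕ, L = List.ofFn g := by
    subst hL
    exact ⟨L.get, (List.ofFn_get L).symm⟩
  have h := (MultilinearMap.mkPiAlgebraFin ℂ n (TensorAlgebra ℂ V)).map_sum_finset
    (fun _ j => x j) (fun p => Finset.univ.filter (fun j => j ∉ U ∧ d j = g p))
  simp only [MultilinearMap.mkPiAlgebraFin_apply] at h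
  rw [List.map_ofFn]
  refine Eq.trans h ?_
  rw [← Finset.sum_filter]
  refine Finset.sum_congr ?_ fun _ _ => rfl
  ext r
  simp only [Fintype.mem_piFinset, Finset.mem_filter, Finset.mem_univ, true_and,
    List.ofFn_inj, funext_iff, Function.comp_apply, forall_and]

theorem thrallElt_pol {n : ℕ} (d : Fin n → ℕ) (x : Fin n → TensorAlgebra ℂ V)
    (U : Finset (Fin n)) (lam : Multiset ℕ) (hl : lam.card = n) :
    thrallElt V (polT V d x U) lam =
      ∑ r : Fin n → Fin n, if (∀ p, r p ∉ U) ∧ List.ofFn (d ∘ r) ∈ P lam then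
        (List.ofFn (x ∘ r)).prod else 0 := by
  rw [thrallElt_eq]
  have : ∀ L ∈ P lam, (L.map (polT V d x U)).prod = _ := fun L hL =>
    polT_prod V d x U L (by rw [← hl, ← mem_P.1 hL, Multiset.coe_card])
  rw [Finset.sum_congr rfl this, Finset.sum_comm]
  refine Finset.sum_congr rfl fun r _ => ?_
  simp only [ite_and]
  split_ifs with h1 h2
  · rw [Finset.sum_ite_eq, if_pos h2]
  · rw [Finset.sum_ite_eq, if_neg h2]
  · simp

theorem alt_sum {n : ℕ} (r : Fin n → Fin n) :
    ∑ U : Finset (Fin n), (if ∀ p, r p ∉ U then (-1 : ℂ) ^ U.card else 0) =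
      if Function.Surjective r then 1 else 0 := by
  classical
  rw [← Finset.sum_filter]
  have h1 : (Finset.univ.filter fun U : Finset (Fin n) => ∀ p, r p ∉ U) =
      ((Finset.univ.image r)ᶜ).powerset := by
    ext U
    simp only [Finset.mem_filter, Finset.mem_univ, true_and, Finset.mem_powerset,
      Finset.subset_iff, Finset.mem_compl, Finset.mem_image, not_exists]
    constructor
    · rintro h a ha p rfl
      exact h p ha
    · intro h p hp
      exact h hp p rfl
  have h2 := congrArg (Int.cast : ℤ → ℂ)
    (Finset.sum_powerset_neg_one_pow_card (x := (Finset.univ.image r)ᶜ))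
  push_cast at h2
  rw [h1, h2]
  refine if_congr ?_ rfl rfl
  rw [Finset.compl_eq_empty_iff]
  simp [Finset.ext_iff, Function.Surjective]

open Classical in
/-- surjections compatible with `lam` -/
noncomputable def F {n : ℕ} (d : Fin n → ℕ) (lam : Multiset ℕ) : Finset (Fin n → Fin n) :=
  Finset.univ.filter fun r => Function.Surjective r ∧ List.ofFn (d ∘ r) ∈ P lam

theorem polar {n k : ℕ} (d : Fin n → ℕ) (x : Fin n → TensorAlgebra ℂ V)
    (hx : ∀ j, x j ∈ lieGrade V (d j)) (lam : Nat.Partition k) (hl : lam.parts.card = n) :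
    ∑ r ∈ F d lam.parts, (List.ofFn (x ∘ r)).prod ∈ thrallModule V lam := by
  classical
  have h : ∑ U : Finset (Fin n), ((-1 : ℂ) ^ U.card) • thrallElt V (polT V d x U) lam.parts
      ∈ thrallModule V lam :=
    Submodule.sum_mem _ fun U _ => Submodule.smul_mem _ _
      (Submodule.subset_span ⟨_, polT_mem V d x hx U, rfl⟩)
  convert h using 1
  simp only [thrallElt_pol V d x _ lam.parts hl, Finset.smul_sum]
  rw [Finset.sum_comm, F, Finset.sum_filter]
  refine Finset.sum_congr rfl fun r _ => ?_
  by_cases h2 : List.ofFn (d ∘ r) ∈ P lam.parts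
  · simp only [h2, and_true, smul_ite, smul_zero]
    have := congrArg (· • (List.ofFn (x ∘ r)).prod) (alt_sum r)
    simp only [Finset.sum_smul, ite_smul, zero_smul, one_smul] at this
    exact this.symm
  · simp [h2]

/-- `Σ_λ W_λ`. -/
noncomputable def S (k : ℕ) : Submodule ℂ (TensorAlgebra ℂ V) :=
  ⨆ lam : Nat.Partition k, thrallModule V lam

theorem isLie_pos {n : ℕ} {x : TensorAlgebra ℂ V} (h : IsLieElem V n x) : 0 < n := by
  induction h with
  | base => exact one_pos
  | bracket _ _ h1 _ => omega

theorem swap_mem (k n : ℕ)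
    (ih : ∀ l : List (ℕ × TensorAlgebra ℂ V), l.length < n → (∀ p ∈ l, IsLieElem V p.1 p.2) →
      (l.map Prod.fst).sum = k → (l.map Prod.snd).prod ∈ S V k)
    {l l' : List (ℕ × TensorAlgebra ℂ V)} (hp : l.Perm l') :
    ∀ q : List (ℕ × TensorAlgebra ℂ V), (q ++ l).length = n →
      (∀ p ∈ q ++ l, IsLieElem V p.1 p.2) → ((q ++ l).map Prod.fst).sum = k →
      ((q ++ l).map Prod.snd).prod - ((q ++ l').map Prod.snd).prod ∈ S V k := by
  induction hp with
  | nil => intro q _ _ _; simp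
  | cons a _ h =>
    intro q h1 h2 h3
    have := h (q ++ [a]) (by simpa using h1) (by simpa using h2) (by simpa using h3)
    simpa using this
  | @swap a b l =>
    intro q h1 h2 h3
    have hb := h2 b (by simp)
    have ha := h2 a (by simp)
    have := ih (q ++ (b.1 + a.1, b.2 * a.2 - a.2 * b.2) :: l)
      (by simp at h1 ⊢; omega)
      (by
        intro p hp
        simp only [List.mem_append, List.mem_cons] at hp
        rcases hp with hp | rfl | hp
        · exact h2 p (by simp [hp])
        · exact IsLieElem.bracket hb ha
        · exact h2 p (by simp [hp]))
      (by simp at h3 ⊢; omega)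
    convert this using 1
    simp only [List.map_append, List.map_cons, List.prod_append, List.prod_cons]
    noncomm_ring
  | @trans l1 l2 l3 hp1 hp2 h h' =>
    intro q h1 h2 h3
    have hq : (q ++ l1).Perm (q ++ l2) := hp1.append_left q
    have e := h' q (by rw [← hq.length_eq]; exact h1) (fun p hp => h2 p (hq.mem_iff.2 hp))
      (by rw [← (hq.map Prod.fst).sum_eq]; exact h3)
    have := Submodule.add_mem _ (h q h1 h2 h3) e
    simpa using this

theorem prod_mem (k : ℕ) : ∀ (n : ℕ) (l : List (ℕ × TensorAlgebra ℂ V)), l.length = n →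
    (∀ p ∈ l, IsLieElem V p.1 p.2) → (l.map Prod.fst).sum = k →
    (l.map Prod.snd).prod ∈ S V k := by
  intro n
  induction n using Nat.strong_induction_on with
  | _ n ih =>
    intro l hl hL hk
    obtain ⟨g, rfl⟩ : ∃ g : Fin n → ℕ × TensorAlgebra ℂ V, l = List.ofFn g := by
      subst hl
      exact ⟨l.get, (List.ofFn_get l).symm⟩
    have hg : ∀ j, IsLieElem V (g j).1 (g j).2 := fun j => hL _ (by simp [List.mem_ofFn])
    let d : Fin n → ℕ := Prod.fst ∘ g
    let x : Fin n → TensorAlgebra ℂ V := Prod.snd ∘ g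
    let lam : Nat.Partition k :=
      { parts := (List.ofFn d : Multiset ℕ)
        parts_pos := by
          intro i hi
          rw [Multiset.mem_coe, List.mem_ofFn] at hi
          obtain ⟨j, rfl⟩ := hi
          exact isLie_pos V (hg j)
        parts_sum := by
          rw [Multiset.sum_coe, ← hk, List.map_ofFn] }
    have hpol : ∑ r ∈ F d lam.parts, (List.ofFn (x ∘ r)).prod ∈ S V k :=
      (le_iSup (fun lam : Nat.Partition k => thrallModule V lam) lam)
        (polar V d x (fun j => Submodule.subset_span (hg j)) lam (by simp [lam]))
    have hdiff : ∑ r ∈ F d lam.parts, ((List.ofFn x).prod - (List.ofFn (x ∘ r)).prod) ∈ S V k := by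
      refine Submodule.sum_mem _ fun r hr => ?_
      have hs : Function.Surjective r := by
        simp only [F, Finset.mem_filter] at hr
        exact hr.2.1
      let σ : Equiv.Perm (Fin n) := Equiv.ofBijective r (Finite.surjective_iff_bijective.1 hs)
      have hperm : (List.ofFn g).Perm (List.ofFn (g ∘ r)) := (σ.ofFn_comp_perm g).symm
      have := swap_mem V k n (fun l h => ih l.length h l rfl) hperm [] hl hL hk
      simp only [List.nil_append, List.map_ofFn] at this
      exact this
    have hadd := Submodule.add_mem _ hdiff hpol
    rw [Finset.sum_sub_distrib, sub_add_cancel, Finset.sum_const,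
      ← Nat.cast_smul_eq_nsmul ℂ] at hadd
    have hid : id ∈ F d lam.parts := by
      simp only [F, Finset.mem_filter, Finset.mem_univ, true_and]
      exact ⟨Function.surjective_id, mem_P.2 rfl⟩
    have hc : ((F d lam.parts).card : ℂ) ≠ 0 := by
      exact_mod_cast (Finset.card_pos.2 ⟨_, hid⟩).ne'
    rw [List.map_ofFn]
    exact (Submodule.smul_mem_iff _ hc).1 hadd

theorem grade_le (k : ℕ) : gradeTA V k ≤ S V k := by
  refine Submodule.span_le.2 ?_
  rintro _ ⟨v, rfl⟩
  have := prod_mem V k k (List.ofFn fun i => ((1 : ℕ), ι ℂ (v i))) (by simp)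
    (by
      intro p hp
      rw [List.mem_ofFn] at hp
      obtain ⟨j, rfl⟩ := hp
      exact IsLieElem.base _)
    (by simp [List.map_ofFn, List.sum_ofFn])
  simp only [List.map_ofFn, Function.comp_def] at this
  exact this

end Thrall

/-- For positive `k`, every tensor in `V^{⊗k}` is uniquely the
sum of one element from each Thrall module `W_λ(V)`, `λ` a partition of `k`. -/
theorem thrall_decomposition (k : ℕ) (hk : 0 < k) :
    ∀ x ∈ gradeTA V k, ∃! c : Nat.Partition k → TensorAlgebra ℂ V,
      (∀ lam : Nat.Partition k, c lam ∈ thrallModule V lam) ∧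
      ∑ lam : Nat.Partition k, c lam = x := by
  intro x hx
  obtain ⟨f, hf, hfx⟩ := (Submodule.mem_iSup_iff_exists_finsupp _ _).1 (Thrall.grade_le V k hx)
  rw [Finsupp.sum_fintype _ _ (fun _ => rfl)] at hfx
  refine ⟨f, ⟨hf, hfx⟩, ?_⟩
  rintro c ⟨hc, hcx⟩
  have := Thrall.indep V (fun lam => c lam - f lam)
    (fun lam => Submodule.sub_mem _ (hc lam) (hf lam))
    (by rw [Finset.sum_sub_distrib, hcx, hfx, sub_self])
  funext lam
  exact sub_eq_zero.1 (this lam)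
end

section
/- Let V be a complex vector space, let λ be a partition of k and μ a partition of ℓ. Suppose β : V^{⊗k} → ℂ is a linear functional that vanishes on W_ν(V) for every partition ν of k with ν ≠ λ, and γ : V^{⊗ℓ} → ℂ is a linear functional that vanishes on W_ν(V) for every partition ν of ℓ with ν ≠ μ. Then the shuffle product β ⧢ γ : V^{⊗(k+ℓ)} → ℂ vanishes on W_ρ(V) for every partition ρ of k+ℓ with ρ ≠ λ ∪ μ. -/
open TensorAlgebra

variable (V : Type*) [AddCommGroup V] [Module ℂ V]

/-- The union `λ ∪ μ` of two partitions: the partition of `k + ℓ` whose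
multiset of parts is the union of the multisets of parts of `λ` and `μ`. -/
def Nat.Partition.union {k l : ℕ} (lam : Nat.Partition k) (mu : Nat.Partition l) :
    Nat.Partition (k + l) where
  parts := lam.parts + mu.parts
  parts_pos := by
    intro i hi
    rcases Multiset.mem_add.mp hi with h | h
    · exact lam.parts_pos h
    · exact mu.parts_pos h
  parts_sum := by rw [Multiset.sum_add, lam.parts_sum, mu.parts_sum]

/-- The elementary tensor `v_{i₁} ⊗ ⋯ ⊗ v_{i_r}` where `i₁ < ⋯ < i_r` are the
elements of the finite set `S` of positions, in increasing order. -/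
noncomputable def ordProd {n : ℕ} (v : Fin n → V) (S : Finset (Fin n)) :
    TensorAlgebra ℂ V :=
  ((S.sort (· ≤ ·)).map fun i => ι ℂ (v i)).prod

/-! ### Generating functions for Thrall elements -/

/-- The generating element `Σ_{i ∈ s} t_i T_i`. -/
noncomputable def genX {A : Type*} [Ring A] (T : ℕ → A) (s : Finset ℕ) :
    AddMonoidAlgebra A (Multiset ℕ) :=
  ∑ i ∈ s, AddMonoidAlgebra.single ({i} : Multiset ℕ) (T i)

/-- Words of length `n` in the alphabet `s`. -/
def wordsOf (s : Finset ℕ) : ℕ → Finset (List ℕ)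
  | 0 => {[]}
  | n + 1 => (s ×ˢ wordsOf s n).image fun p => p.1 :: p.2

theorem mem_wordsOf (s : Finset ℕ) (n : ℕ) (L : List ℕ) :
    L ∈ wordsOf s n ↔ L.length = n ∧ ∀ i ∈ L, i ∈ s := by
  induction n generalizing L with
  | zero =>
    simp only [wordsOf, Finset.mem_singleton, List.length_eq_zero_iff]
    constructor
    · rintro rfl; simp
    · exact fun h => h.1
  | succ n ih =>
    simp only [wordsOf, Finset.mem_image, Finset.mem_product, Prod.exists]
    constructor
    · rintro ⟨a, l, ⟨ha, hl⟩, rfl⟩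
      have := (ih l).1 hl
      simpa [this.1, ha] using this.2
    · cases L with
      | nil => simp
      | cons a l =>
        rintro ⟨h1, h2⟩
        refine ⟨a, l, ⟨h2 a (by simp), (ih l).2 ⟨by simpa using h1, fun i hi => h2 i (by simp [hi])⟩⟩, rfl⟩

theorem genX_pow {A : Type*} [Ring A] (T : ℕ → A) (s : Finset ℕ) (n : ℕ) :
    genX T s ^ n =
      ∑ L ∈ wordsOf s n, AddMonoidAlgebra.single (L : Multiset ℕ) (L.map T).prod := by
  induction n with
  | zero => simp [wordsOf, AddMonoidAlgebra.one_def]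
  | succ n ih =>
    rw [pow_succ', ih, wordsOf, Finset.sum_image, Finset.sum_product, genX, Finset.sum_mul_sum]
    · refine Finset.sum_congr rfl fun i _ => Finset.sum_congr rfl fun L _ => ?_
      rw [AddMonoidAlgebra.single_mul_single]
      simp
    · rintro ⟨a, l⟩ _ ⟨b, m⟩ _ h
      simpa using h

theorem coeff_genX_pow {A : Type*} [Ring A] (T : ℕ → A) (s : Finset ℕ) (n : ℕ)
    (ν : Multiset ℕ) :
    (genX T s ^ n).coeff ν =
      ∑ L ∈ (wordsOf s n).filter (fun L : List ℕ => (L : Multiset ℕ) = ν), (L.map T).prod := by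
  rw [genX_pow, AddMonoidAlgebra.coeff_sum, Finsupp.finsetSum_apply, Finset.sum_filter]
  refine Finset.sum_congr rfl fun L _ => ?_
  simp [Finsupp.single_apply]

theorem coeff_genX_pow_ne {A : Type*} [Ring A] (T : ℕ → A) (s : Finset ℕ) (n : ℕ)
    (ν : Multiset ℕ) (h : ν.card ≠ n) : (genX T s ^ n).coeff ν = 0 := by
  rw [coeff_genX_pow]
  apply Finset.sum_eq_zero
  intro L hL
  rw [Finset.mem_filter, mem_wordsOf] at hL
  exact absurd (by rw [← hL.2, Multiset.coe_card, hL.1.1]) h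

theorem coeff_genX_pow_card (T : ℕ → TensorAlgebra ℂ V) (s : Finset ℕ)
    (ν : Multiset ℕ) (h : ∀ i ∈ ν, i ∈ s) :
    (genX T s ^ ν.card).coeff ν = thrallElt V T ν := by
  rw [coeff_genX_pow, thrallElt, ← List.sum_toFinset _ (List.nodup_dedup _)]
  refine Finset.sum_congr ?_ fun _ _ => rfl
  ext L
  rw [Finset.mem_filter, mem_wordsOf, List.mem_toFinset, List.mem_dedup, List.mem_permutations,
    ← Multiset.coe_eq_coe, Multiset.coe_toList]
  constructor
  · exact fun h => h.2
  · rintro rfl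
    exact ⟨⟨by simp, by simpa using h⟩, rfl⟩

theorem map_genX {A B : Type*} [Ring A] [Ring B] (f : A →+* B) (T : ℕ → A) (s : Finset ℕ) :
    AddMonoidAlgebra.mapRingHom (Multiset ℕ) f (genX T s) = genX (fun i => f (T i)) s := by
  simp [genX]

theorem map_coeff_genX_pow {A B : Type*} [Ring A] [Ring B] (f : A →+* B) (T : ℕ → A)
    (s : Finset ℕ) (n : ℕ) (ν : Multiset ℕ) :
    f ((genX T s ^ n).coeff ν) = (genX (fun i => f (T i)) s ^ n).coeff ν := by
  rw [← map_genX, ← map_pow, AddMonoidAlgebra.coeff_mapRingHom]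

/-! ### The coproduct -/

open scoped TensorProduct

/-- The unshuffle coproduct. -/
noncomputable def coprod :
    TensorAlgebra ℂ V →ₐ[ℂ] TensorAlgebra ℂ V ⊗[ℂ] TensorAlgebra ℂ V :=
  TensorAlgebra.lift ℂ
    ((TensorProduct.mk ℂ _ _).flip 1 ∘ₗ ι ℂ + (TensorProduct.mk ℂ _ _ 1) ∘ₗ ι ℂ)

theorem coprod_ι (v : V) : coprod V (ι ℂ v) = ι ℂ v ⊗ₜ 1 + 1 ⊗ₜ ι ℂ v := by
  simp [coprod]

theorem isLieElem_primitive {i : ℕ} {x : TensorAlgebra ℂ V} (h : IsLieElem V i x) :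
    coprod V x = x ⊗ₜ 1 + 1 ⊗ₜ x := by
  induction h with
  | base v => exact coprod_ι V v
  | bracket _ _ hx hy =>
    rw [map_sub, map_mul, map_mul, hx, hy]
    simp only [mul_add, add_mul, Algebra.TensorProduct.tmul_mul_tmul, one_mul, mul_one,
      TensorProduct.sub_tmul, TensorProduct.tmul_sub]
    abel

theorem isLieElem_homog {i : ℕ} {x : TensorAlgebra ℂ V} (h : IsLieElem V i x) :
    x ∈ (LinearMap.range (ι ℂ : V →ₗ[ℂ] TensorAlgebra ℂ V)) ^ i := by
  induction h with
  | base v => simp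
  | bracket _ _ hx hy =>
    refine Submodule.sub_mem _ ?_ ?_
    · rw [pow_add]; exact Submodule.mul_mem_mul hx hy
    · rw [add_comm, pow_add]; exact Submodule.mul_mem_mul hy hx

theorem lieGrade_primitive {i : ℕ} {x : TensorAlgebra ℂ V} (h : x ∈ lieGrade V i) :
    coprod V x = x ⊗ₜ 1 + 1 ⊗ₜ x := by
  induction h using Submodule.span_induction with
  | mem x hx => exact isLieElem_primitive V hx
  | zero => simp
  | add x y _ _ hx hy =>
    rw [map_add, hx, hy, TensorProduct.add_tmul, TensorProduct.tmul_add]; abel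
  | smul c x _ hx =>
    rw [map_smul, hx, smul_add, TensorProduct.smul_tmul', TensorProduct.tmul_smul]

theorem lieGrade_homog {i : ℕ} {x : TensorAlgebra ℂ V} (h : x ∈ lieGrade V i) :
    x ∈ (LinearMap.range (ι ℂ : V →ₗ[ℂ] TensorAlgebra ℂ V)) ^ i :=
  (Submodule.span_le.2 fun _ hy => isLieElem_homog V hy) h

theorem prod_homog (T : ℕ → TensorAlgebra ℂ V) (hT : ∀ i, T i ∈ lieGrade V i) (L : List ℕ) :
    (L.map T).prod ∈ (LinearMap.range (ι ℂ : V →ₗ[ℂ] TensorAlgebra ℂ V)) ^ L.sum := by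
  induction L with
  | nil => simp [Submodule.one_le.1 le_rfl]
  | cons a l ih =>
    rw [List.map_cons, List.prod_cons, List.sum_cons, pow_add]
    exact Submodule.mul_mem_mul (lieGrade_homog V (hT a)) ih

theorem coeff_genX_homog (T : ℕ → TensorAlgebra ℂ V) (hT : ∀ i, T i ∈ lieGrade V i)
    (s : Finset ℕ) (n : ℕ) (ν : Multiset ℕ) :
    (genX T s ^ n).coeff ν ∈
      (LinearMap.range (ι ℂ : V →ₗ[ℂ] TensorAlgebra ℂ V)) ^ ν.sum := by
  rw [coeff_genX_pow]
  refine Submodule.sum_mem _ fun L hL => ?_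
  rw [← (Finset.mem_filter.1 hL).2, Multiset.sum_coe]
  exact prod_homog V T hT L

/-- The coproduct of a Thrall element. -/
theorem coprod_thrallElt (T : ℕ → TensorAlgebra ℂ V) (hT : ∀ i, T i ∈ lieGrade V i)
    (ρ : Multiset ℕ) :
    coprod V (thrallElt V T ρ) =
      ∑ j ∈ Finset.range (ρ.card + 1), ∑ p ∈ (Multiset.antidiagonal ρ).toFinset,
        (ρ.card.choose j) • ((genX T ρ.toFinset ^ j).coeff p.1 ⊗ₜ[ℂ]
          (genX T ρ.toFinset ^ (ρ.card - j)).coeff p.2) := by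
  rw [← coeff_genX_pow_card V T ρ.toFinset ρ (by simp)]
  have e := map_coeff_genX_pow (coprod V).toRingHom T ρ.toFinset ρ.card ρ
  rw [show coprod V ((genX T ρ.toFinset ^ ρ.card).coeff ρ) = _ from e]
  let f1 : TensorAlgebra ℂ V →+* TensorAlgebra ℂ V ⊗[ℂ] TensorAlgebra ℂ V :=
    (Algebra.TensorProduct.includeLeft :
      TensorAlgebra ℂ V →ₐ[ℂ] TensorAlgebra ℂ V ⊗[ℂ] TensorAlgebra ℂ V).toRingHom
  let f2 : TensorAlgebra ℂ V →+* TensorAlgebra ℂ V ⊗[ℂ] TensorAlgebra ℂ V :=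
    (Algebra.TensorProduct.includeRight :
      TensorAlgebra ℂ V →ₐ[ℂ] TensorAlgebra ℂ V ⊗[ℂ] TensorAlgebra ℂ V).toRingHom
  have hf1 : ∀ x, f1 x = x ⊗ₜ 1 := fun x => rfl
  have hf2 : ∀ x, f2 x = 1 ⊗ₜ x := fun x => rfl
  have h : genX (fun i => (coprod V).toRingHom (T i)) ρ.toFinset =
      genX (fun i => f1 (T i)) ρ.toFinset + genX (fun i => f2 (T i)) ρ.toFinset := by
    simp only [genX, ← Finset.sum_add_distrib, ← AddMonoidAlgebra.single_add]
    refine Finset.sum_congr rfl fun i _ => ?_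
    congr 1
    exact lieGrade_primitive V (hT i)
  have hc : Commute (genX (fun i => f1 (T i)) ρ.toFinset)
      (genX (fun i => f2 (T i)) ρ.toFinset) := by
    refine Commute.sum_left _ _ _ fun i _ => Commute.sum_right _ _ _ fun j _ => ?_
    apply AddMonoidAlgebra.single_commute_single (add_comm _ _)
    simp [Commute, SemiconjBy, hf1, hf2]
  rw [h, hc.add_pow, AddMonoidAlgebra.coeff_sum, Finsupp.finsetSum_apply]
  refine Finset.sum_congr rfl fun j _ => ?_
  rw [← (Nat.cast_commute _ _).eq, ← nsmul_eq_mul, AddMonoidAlgebra.coeff_smul, Finsupp.smul_apply,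
    AddMonoidAlgebra.coeff_mul_antidiag _ _ _ (Multiset.antidiagonal ρ).toFinset (by simp), Finset.smul_sum]
  refine Finset.sum_congr rfl fun p _ => ?_
  rw [← map_coeff_genX_pow, ← map_coeff_genX_pow, hf1, hf2]
  simp

/-! ### The coproduct on elementary tensors -/

theorem coprod_list {n : ℕ} (v : Fin n → V) (L : List (Fin n)) (hL : L.Pairwise (· < ·)) :
    coprod V (L.map fun i => ι ℂ (v i)).prod =
      ∑ S ∈ L.toFinset.powerset, ordProd V v S ⊗ₜ[ℂ] ordProd V v (L.toFinset \ S) := by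
  induction L with
  | nil => simp [ordProd, Algebra.TensorProduct.one_def]
  | cons a l ih =>
    rw [List.pairwise_cons] at hL
    have ha : a ∉ l.toFinset := fun h => lt_irrefl a (hL.1 a (List.mem_toFinset.1 h))
    have key : ∀ S ⊆ l.toFinset, ordProd V v (insert a S) = ι ℂ (v a) * ordProd V v S := by
      intro S hS
      rw [ordProd, Finset.sort_insert]
      · simp [ordProd]
      · exact fun b hb => (hL.1 b (List.mem_toFinset.1 (hS hb))).le
      · exact fun h => ha (hS h)
    rw [List.map_cons, List.prod_cons, map_mul, ih hL.2, coprod_ι, List.toFinset_cons,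
      Finset.sum_powerset_insert ha, add_mul, Finset.mul_sum, Finset.mul_sum, add_comm]
    congr 1
    · refine Finset.sum_congr rfl fun S hS => ?_
      rw [Finset.mem_powerset] at hS
      rw [Finset.insert_sdiff_of_notMem _ (fun h => ha (hS h)), key _ Finset.sdiff_subset]
      simp
    · refine Finset.sum_congr rfl fun S hS => ?_
      rw [Finset.mem_powerset] at hS
      rw [key S hS, Finset.insert_sdiff_insert, Finset.sdiff_insert_of_notMem ha]
      simp

theorem coprod_ordProd {n : ℕ} (v : Fin n → V) :
    coprod V (ordProd V v Finset.univ) =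
      ∑ S : Finset (Fin n), ordProd V v S ⊗ₜ[ℂ] ordProd V v Sᶜ := by
  have h := coprod_list V v (Finset.univ.sort (· ≤ ·)) (Finset.sortedLT_sort _).pairwise
  rw [Finset.sort_toFinset, Finset.powerset_univ] at h
  simpa [ordProd, Finset.compl_eq_univ_sdiff] using h

theorem ordProd_homog {n : ℕ} (v : Fin n → V) (S : Finset (Fin n)) :
    ordProd V v S ∈ (LinearMap.range (ι ℂ : V →ₗ[ℂ] TensorAlgebra ℂ V)) ^ S.card := by
  have h : ∀ L : List (Fin n), (L.map fun i => ι ℂ (v i)).prod ∈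
      (LinearMap.range (ι ℂ : V →ₗ[ℂ] TensorAlgebra ℂ V)) ^ L.length := by
    intro L
    induction L with
    | nil => simp [Submodule.one_le.1 le_rfl]
    | cons a l ih =>
      rw [List.map_cons, List.prod_cons, List.length_cons, pow_succ']
      exact Submodule.mul_mem_mul ⟨_, rfl⟩ ih
  simpa [ordProd] using h (S.sort (· ≤ ·))

theorem homog_induction {n : ℕ} (f g : TensorAlgebra ℂ V →ₗ[ℂ] ℂ)
    (h : ∀ v : Fin n → V, f (ordProd V v Finset.univ) = g (ordProd V v Finset.univ))
    (x : TensorAlgebra ℂ V)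
    (hx : x ∈ (LinearMap.range (ι ℂ : V →ₗ[ℂ] TensorAlgebra ℂ V)) ^ n) : f x = g x := by
  rw [← Submodule.span_eq (LinearMap.range (ι ℂ : V →ₗ[ℂ] TensorAlgebra ℂ V)),
    Submodule.span_pow] at hx
  refine LinearMap.eqOn_span (f := f) (g := g) ?_ hx
  intro y hy
  obtain ⟨F, rfl⟩ := Set.mem_pow.1 hy
  choose v hv using fun i => (F i).2
  have e : (List.ofFn fun i => (F i : TensorAlgebra ℂ V)).prod = ordProd V v Finset.univ := by
    rw [ordProd, Fin.sort_univ, ← List.ofFn_eq_map]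
    simp only [hv]
  rw [e]
  exact h v

/-- `β` restricted to degree `k` and extended by zero. -/
noncomputable def restrDeg (k : ℕ) (β : TensorAlgebra ℂ V →ₗ[ℂ] ℂ) :
    TensorAlgebra ℂ V →ₗ[ℂ] ℂ :=
  β ∘ₗ GradedAlgebra.proj ((LinearMap.range (ι ℂ : V →ₗ[ℂ] TensorAlgebra ℂ V) ^ · : ℕ → Submodule ℂ (TensorAlgebra ℂ V))) k

theorem restrDeg_same {k : ℕ} (β : TensorAlgebra ℂ V →ₗ[ℂ] ℂ) {x : TensorAlgebra ℂ V}
    (hx : x ∈ (LinearMap.range (ι ℂ : V →ₗ[ℂ] TensorAlgebra ℂ V)) ^ k) :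
    restrDeg V k β x = β x := by
  rw [restrDeg, LinearMap.comp_apply, GradedAlgebra.proj_apply]
  congr 1
  exact DirectSum.decompose_of_mem_same
    ((LinearMap.range (ι ℂ : V →ₗ[ℂ] TensorAlgebra ℂ V) ^ · : ℕ → Submodule ℂ (TensorAlgebra ℂ V))) hx

theorem restrDeg_ne {k m : ℕ} (β : TensorAlgebra ℂ V →ₗ[ℂ] ℂ) {x : TensorAlgebra ℂ V}
    (hx : x ∈ (LinearMap.range (ι ℂ : V →ₗ[ℂ] TensorAlgebra ℂ V)) ^ m) (h : m ≠ k) :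
    restrDeg V k β x = 0 := by
  rw [restrDeg, LinearMap.comp_apply, GradedAlgebra.proj_apply]
  have := DirectSum.decompose_of_mem_ne
    ((LinearMap.range (ι ℂ : V →ₗ[ℂ] TensorAlgebra ℂ V) ^ · : ℕ → Submodule ℂ (TensorAlgebra ℂ V))) hx h
  exact (congrArg β this).trans (map_zero β)

/-- The functional `β' ⊗ γ'` on the tensor square. -/
noncomputable def tensorFun (β γ : TensorAlgebra ℂ V →ₗ[ℂ] ℂ) :
    TensorAlgebra ℂ V ⊗[ℂ] TensorAlgebra ℂ V →ₗ[ℂ] ℂ :=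
  LinearMap.mul' ℂ ℂ ∘ₗ TensorProduct.map β γ

theorem tensorFun_tmul (β γ : TensorAlgebra ℂ V →ₗ[ℂ] ℂ) (x y : TensorAlgebra ℂ V) :
    tensorFun V β γ (x ⊗ₜ y) = β x * γ y := by
  simp [tensorFun]

theorem shuffle_eq (k l : ℕ) (β γ δ : TensorAlgebra ℂ V →ₗ[ℂ] ℂ)
    (hδ : ∀ v : Fin (k + l) → V,
      δ (ordProd V v Finset.univ) =
        ∑ S ∈ Finset.univ.powersetCard k, β (ordProd V v S) * γ (ordProd V v Sᶜ))
    (x : TensorAlgebra ℂ V)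
    (hx : x ∈ (LinearMap.range (ι ℂ : V →ₗ[ℂ] TensorAlgebra ℂ V)) ^ (k + l)) :
    δ x = tensorFun V (restrDeg V k β) (restrDeg V l γ) (coprod V x) := by
  refine homog_induction V δ
    (tensorFun V (restrDeg V k β) (restrDeg V l γ) ∘ₗ (coprod V).toLinearMap) ?_ x hx
  intro v
  rw [hδ, LinearMap.comp_apply, AlgHom.toLinearMap_apply, coprod_ordProd, map_sum]
  simp only [tensorFun_tmul]
  symm
  refine (Finset.sum_subset (Finset.subset_univ (Finset.univ.powersetCard k)) ?_).symm.trans ?_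
  · intro S _ hS
    rw [restrDeg_ne V β (ordProd_homog V v S) (by simpa [Finset.mem_powersetCard] using hS),
      zero_mul]
  · refine Finset.sum_congr rfl fun S hS => ?_
    have hc : S.card = k := (Finset.mem_powersetCard.1 hS).2
    have h1 := ordProd_homog V v S
    have h2 := ordProd_homog V v Sᶜ
    rw [hc] at h1
    rw [Finset.card_compl, hc, Fintype.card_fin, Nat.add_sub_cancel_left] at h2
    rw [restrDeg_same V β h1, restrDeg_same V γ h2]

theorem restrDeg_coeff_eq_zero {k : ℕ} (lam : Nat.Partition k) (β : TensorAlgebra ℂ V →ₗ[ℂ] ℂ)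
    (hβ : ∀ ν : Nat.Partition k, ν ≠ lam → ∀ x ∈ thrallModule V ν, β x = 0)
    (T : ℕ → TensorAlgebra ℂ V) (hT : ∀ i, T i ∈ lieGrade V i) (s : Finset ℕ)
    (ν : Multiset ℕ) (hs : ∀ i ∈ ν, i ∈ s) (hpos : ∀ i ∈ ν, 0 < i) (hne : ν ≠ lam.parts) (j : ℕ) :
    restrDeg V k β ((genX T s ^ j).coeff ν) = 0 := by
  have hh := coeff_genX_homog V T hT s j ν
  by_cases hsum : ν.sum = k
  · rw [hsum] at hh
    rw [restrDeg_same V β hh]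
    by_cases hj : ν.card = j
    · subst hj
      rw [coeff_genX_pow_card V T s ν hs]
      refine hβ ⟨ν, fun h => hpos _ h, hsum⟩ (fun h => hne (by rw [← h])) _
        (Submodule.subset_span ⟨T, hT, rfl⟩)
    · rw [coeff_genX_pow_ne T s j ν hj, map_zero]
  · exact restrDeg_ne V β hh hsum

/-- If the linear functional `β` on `V^{⊗k}` vanishes on all
Thrall modules `W_ν(V)`, `ν ≠ λ`, the linear functional `γ` on `V^{⊗ℓ}`
vanishes on all `W_ν(V)`, `ν ≠ μ`, and `δ` is their shuffle product
(characterized on elementary tensors), then `δ` vanishes on all Thrall modules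
`W_ρ(V)` with `ρ ≠ λ ∪ μ`. -/
theorem shuffle_thrall_grading (k l : ℕ) (hk : 0 < k) (hl : 0 < l)
    (lam : Nat.Partition k) (mu : Nat.Partition l)
    (β γ δ : TensorAlgebra ℂ V →ₗ[ℂ] ℂ)
    (hβ : ∀ ν : Nat.Partition k, ν ≠ lam → ∀ x ∈ thrallModule V ν, β x = 0)
    (hγ : ∀ ν : Nat.Partition l, ν ≠ mu → ∀ x ∈ thrallModule V ν, γ x = 0)
    (hδ : ∀ v : Fin (k + l) → V,
      δ (ordProd V v Finset.univ) =
        ∑ S ∈ Finset.univ.powersetCard k, β (ordProd V v S) * γ (ordProd V v Sᶜ)) :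
    ∀ ρ : Nat.Partition (k + l), ρ ≠ lam.union mu →
      ∀ x ∈ thrallModule V ρ, δ x = 0 := by
  intro ρ hρ x hx
  suffices h : thrallModule V ρ ≤ LinearMap.ker δ from h hx
  refine Submodule.span_le.2 ?_
  rintro _ ⟨T, hT, rfl⟩
  rw [SetLike.mem_coe, LinearMap.mem_ker]
  have hh : thrallElt V T ρ.parts ∈
      (LinearMap.range (ι ℂ : V →ₗ[ℂ] TensorAlgebra ℂ V)) ^ (k + l) := by
    have := coeff_genX_homog V T hT ρ.parts.toFinset ρ.parts.card ρ.parts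
    rwa [coeff_genX_pow_card V T _ _ (by simp), ρ.parts_sum] at this
  rw [shuffle_eq V k l β γ δ hδ _ hh, coprod_thrallElt V T hT, map_sum]
  refine Finset.sum_eq_zero fun j _ => ?_
  rw [map_sum]
  refine Finset.sum_eq_zero fun p hp => ?_
  rw [Multiset.mem_toFinset, Multiset.mem_antidiagonal] at hp
  rw [map_nsmul, tensorFun_tmul]
  have m1 : ∀ i ∈ p.1, i ∈ ρ.parts := fun i hi => hp ▸ Multiset.mem_add.2 (Or.inl hi)
  have m2 : ∀ i ∈ p.2, i ∈ ρ.parts := fun i hi => hp ▸ Multiset.mem_add.2 (Or.inr hi)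
  by_cases h1 : p.1 = lam.parts
  · have h2 : p.2 ≠ mu.parts := by
      intro h2
      apply hρ
      apply Nat.Partition.ext
      rw [← hp, h1, h2]
      rfl
    rw [restrDeg_coeff_eq_zero V mu γ hγ T hT _ p.2 (by simpa using m2)
      (fun i hi => ρ.parts_pos (m2 i hi)) h2]
    simp
  · rw [restrDeg_coeff_eq_zero V lam β hβ T hT _ p.1 (by simpa using m1)
      (fun i hi => ρ.parts_pos (m1 i hi)) h1]
    simp
end

section
/- Let V be a complex vector space, k ≥ 2, and T_i ∈ Lie^i V for 1 ≤ i ≤ k with T₁ ≠ 0. If φ_k(T₁,…,T_k) is symmetric (invariant under every permutation of the k tensor factors), then T_i = 0 for every i ∈ {2,…,k}, and consequently φ_i(T₁,…,T_i) = (1/i!)·T₁^{⊗i} is symmetric for every i ∈ {1,…,k}. -/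
open TensorAlgebra

variable (V : Type*) [AddCommGroup V] [Module ℂ V]

/-- `φ_k(T₁,…,T_k) = Σ_α (1/ℓ!)·T_{α₁} ⊗ ⋯ ⊗ T_{α_ℓ}`, summing over all
compositions `α = (α₁,…,α_ℓ)` of `k`; this is the degree-`k` component of
`exp(T₁ + T₂ + ⋯)` in the tensor algebra. -/
noncomputable def phiTA (k : ℕ) (T : ℕ → TensorAlgebra ℂ V) : TensorAlgebra ℂ V :=
  ∑ c : Composition k, ((c.length).factorial : ℂ)⁻¹ • (c.blocks.map T).prod

/-- `IsSymmetricAt V k x`: the degree-`k` tensor `x` is invariant under every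
permutation of the `k` tensor factors.  This is expressed via the maps `P`
implementing the permutation `σ` on elementary tensors of degree `k`. -/
def IsSymmetricAt (k : ℕ) (x : TensorAlgebra ℂ V) : Prop :=
  ∀ σ : Equiv.Perm (Fin k), ∀ P : TensorAlgebra ℂ V →ₗ[ℂ] TensorAlgebra ℂ V,
    (∀ v : Fin k → V,
      P ((List.ofFn fun i => ι ℂ (v i)).prod) = (List.ofFn fun i => ι ℂ (v (σ i))).prod) →
    P x = x


section Aux
variable {V}

/-- the derivation, as an algebra map into the trivial square zero extension -/
noncomputable def auxHom (f : V →ₗ[ℂ] ℂ) :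
    TensorAlgebra ℂ V →ₐ[ℂ] TrivSqZeroExt (TensorAlgebra ℂ V) (TensorAlgebra ℂ V) :=
  TensorAlgebra.lift ℂ
     { toFun := fun w => TrivSqZeroExt.inl (ι ℂ w) +
          TrivSqZeroExt.inr (f w • (1 : TensorAlgebra ℂ V))
       map_add' := by
        intro x y
        ext <;> simp [add_smul]
       map_smul' := by
        intro c x
        ext <;> simp [mul_smul] }

theorem auxHom_fst (f : V →ₗ[ℂ] ℂ) (x : TensorAlgebra ℂ V) : (auxHom f x).fst = x := by
  have : (TrivSqZeroExt.fstHom ℂ (TensorAlgebra ℂ V) (TensorAlgebra ℂ V)).comp (auxHom f)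
      = AlgHom.id ℂ _ := by
    ext w
    simp [auxHom]
  exact DFunLike.congr_fun this x

/-- the derivation -/
noncomputable def auxD (f : V →ₗ[ℂ] ℂ) : TensorAlgebra ℂ V →ₗ[ℂ] TensorAlgebra ℂ V :=
  (TrivSqZeroExt.sndHom (TensorAlgebra ℂ V) (TensorAlgebra ℂ V)).restrictScalars ℂ ∘ₗ
    (auxHom f).toLinearMap

theorem auxD_mul (f : V →ₗ[ℂ] ℂ) (x y : TensorAlgebra ℂ V) :
    auxD f (x * y) = auxD f x * y + x * auxD f y := by
  simp [auxD, auxHom_fst, add_comm]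

theorem auxD_ι (f : V →ₗ[ℂ] ℂ) (w : V) :
    auxD f (ι ℂ w) = algebraMap ℂ _ (f w) := by
  simp [auxD, auxHom, Algebra.algebraMap_eq_smul_one]

theorem auxD_algebraMap (f : V →ₗ[ℂ] ℂ) (c : ℂ) :
    auxD f (algebraMap ℂ _ c) = 0 := by
  simp [auxD, TrivSqZeroExt.algebraMap_eq_inl']

theorem auxD_one (f : V →ₗ[ℂ] ℂ) :
    auxD f 1 = 0 := by
  simp [auxD]

/-- algebra map used for the left contraction -/
noncomputable def auxEnd (f : V →ₗ[ℂ] ℂ) :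
    TensorAlgebra ℂ V →ₐ[ℂ] Module.End ℂ (TensorAlgebra ℂ V × TensorAlgebra ℂ V) :=
  TensorAlgebra.lift ℂ
    { toFun := fun w => LinearMap.prod
          (f w • LinearMap.snd ℂ _ _) (LinearMap.mulLeft ℂ (ι ℂ w) ∘ₗ LinearMap.snd ℂ _ _)
      map_add' := by
        intro x y
        ext <;> simp [add_smul, add_mul]
      map_smul' := by
        intro c x
        ext <;> simp [mul_smul] }

theorem auxEnd_snd (f : V →ₗ[ℂ] ℂ) (x : TensorAlgebra ℂ V) :
    ∀ p, (auxEnd f x p).2 = x * p.2 := by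
  induction x using TensorAlgebra.induction with
  | algebraMap r => intro p; simp [Algebra.smul_def]
  | ι w => intro p; simp [auxEnd]
  | mul a b ha hb => intro p; simp [ha, hb, mul_assoc]
  | add a b ha hb => intro p; simp [ha, hb, add_mul]

/-- left contraction -/
noncomputable def auxC (f : V →ₗ[ℂ] ℂ) : TensorAlgebra ℂ V →ₗ[ℂ] TensorAlgebra ℂ V :=
  LinearMap.fst ℂ _ _ ∘ₗ (LinearMap.applyₗ (0, 1)) ∘ₗ (auxEnd f).toLinearMap

theorem auxC_ι_mul (f : V →ₗ[ℂ] ℂ) (w : V) (x : TensorAlgebra ℂ V) :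
    auxC f (ι ℂ w * x) = f w • x := by
  have h := auxEnd_snd f x (0, 1)
  simp only [mul_one] at h
  have : auxEnd f (ι ℂ w) = LinearMap.prod
          (f w • LinearMap.snd ℂ _ _) (LinearMap.mulLeft ℂ (ι ℂ w) ∘ₗ LinearMap.snd ℂ _ _) := by
    simp [auxEnd]
  simp [auxC, this, h]

/-- elementary tensors -/
noncomputable def auxT (n : ℕ) (v : Fin n → V) : TensorAlgebra ℂ V :=
  (List.ofFn fun i => ι ℂ (v i)).prod

theorem auxT_succ (n : ℕ) (v : Fin (n+1) → V) :
    auxT (n+1) v = ι ℂ (v 0) * auxT n (fun i => v i.succ) := by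
  simp [auxT, List.ofFn_succ]

theorem auxD_auxT (f : V →ₗ[ℂ] ℂ) (n : ℕ) (v : Fin (n+1) → V) :
    auxD f (auxT (n+1) v) = ∑ j, f (v j) • auxT n (fun i => v (j.succAbove i)) := by
  induction n with
  | zero =>
    simp [auxT, auxD_ι, Algebra.smul_def]
  | succ n ih =>
    rw [auxT_succ, auxD_mul, auxD_ι, ih, Fin.sum_univ_succ (n := n + 1), ← Algebra.smul_def]
    congr 1
    rw [Finset.mul_sum]
    refine Finset.sum_congr rfl fun j _ => ?_
    rw [auxT_succ n (fun i => v (j.succ.succAbove i))]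
    simp

/-- permutation operator -/
noncomputable def auxP (n : ℕ) (σ : Equiv.Perm (Fin n)) :
    TensorAlgebra ℂ V →ₗ[ℂ] TensorAlgebra ℂ V :=
  PiTensorProduct.lift ((TensorAlgebra.tprod ℂ V n).domDomCongr σ) ∘ₗ
    DirectSum.component ℂ ℕ (fun n => TensorPower ℂ n V) n ∘ₗ
    (TensorAlgebra.equivDirectSum (R := ℂ) (M := V)).toLinearMap

theorem auxP_auxT (n : ℕ) (σ : Equiv.Perm (Fin n)) (v : Fin n → V) :
    auxP n σ (auxT n v) = auxT n (fun i => v (σ i)) := by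
  have h : auxT n v = TensorAlgebra.tprod ℂ V n v := by
    simp [auxT, TensorAlgebra.tprod_apply]
  have h' : auxT n (fun i => v (σ i)) = TensorAlgebra.tprod ℂ V n (fun i => v (σ i)) := by
    simp [auxT, TensorAlgebra.tprod_apply]
  rw [h, h']
  simp only [auxP, LinearMap.comp_apply, AlgEquiv.toLinearMap_apply]
  rw [show TensorAlgebra.equivDirectSum (TensorAlgebra.tprod ℂ V n v) = _ from
    TensorAlgebra.toDirectSum_tensorPower_tprod v]
  rw [← DirectSum.lof_eq_of ℂ, DirectSum.component.lof_self]
  simp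

/-- degree n part -/
noncomputable def auxG (V : Type*) [AddCommGroup V] [Module ℂ V] (n : ℕ) :
    Submodule ℂ (TensorAlgebra ℂ V) := (LinearMap.range (ι ℂ : V →ₗ[ℂ] _)) ^ n

theorem auxG_eq (n : ℕ) : auxG V n = Submodule.span ℂ (Set.range (auxT (V := V) n)) := by
  rw [auxG, Submodule.pow_eq_span_pow_set]
  congr 1
  ext x
  rw [Set.mem_pow]
  constructor
  · rintro ⟨g, rfl⟩
    choose v hv using fun i => (g i).2
    exact ⟨v, by simp [auxT, hv]⟩
  · rintro ⟨v, rfl⟩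
    exact ⟨fun i => ⟨ι ℂ (v i), LinearMap.mem_range_self _ _⟩, rfl⟩

theorem auxD_symm (f : V →ₗ[ℂ] ℂ) (n : ℕ) (x : TensorAlgebra ℂ V) (hx : x ∈ auxG V (n+1))
    (hs : IsSymmetricAt V (n+1) x) : auxD f x = ((n : ℂ) + 1) • auxC f x := by
  have key : auxD f x = ∑ j, auxC f (auxP (n+1) (Fin.cycleRange j).symm x) := by
    clear hs
    rw [auxG_eq] at hx
    induction hx using Submodule.span_induction with
    | mem x h =>
      obtain ⟨v, rfl⟩ := h
      rw [auxD_auxT]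
      refine Finset.sum_congr rfl fun j _ => ?_
      rw [auxP_auxT, auxT_succ, auxC_ι_mul]
      simp
    | zero => simp
    | add x y _ _ hx hy => simp [hx, hy, Finset.sum_add_distrib]
    | smul c x _ hx => simp [hx, Finset.smul_sum]
  rw [key]
  rw [Finset.sum_congr rfl (fun j _ => by rw [hs _ _ (auxP_auxT (n+1) (Fin.cycleRange j).symm)])]
  simp [← Nat.cast_smul_eq_nsmul ℂ]

theorem auxC_sep (n : ℕ) (x : TensorAlgebra ℂ V) (hx : x ∈ auxG V (n+1))
    (h : ∀ f : V →ₗ[ℂ] ℂ, auxC f x = 0) : x = 0 := by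
  let b := Module.Basis.ofVectorSpace ℂ V
  let Φ : (Module.Basis.ofVectorSpaceIndex ℂ V →₀ TensorAlgebra ℂ V) →ₗ[ℂ] TensorAlgebra ℂ V :=
    Finsupp.lsum ℂ (fun i => LinearMap.mulLeft ℂ (ι ℂ (b i)))
  have hΦ : ∀ y i, auxC (b.coord i) (Φ y) = y i := by
    intro y i
    induction y using Finsupp.induction_linear with
    | zero => simp
    | add y z hy hz => simp [hy, hz]
    | single j z =>
      simp only [Φ, Finsupp.lsum_single, LinearMap.mulLeft_apply, auxC_ι_mul]
      by_cases hij : j = i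
      · subst hij; simp
      · simp [Finsupp.single_apply, hij]
  have hr : x ∈ LinearMap.range Φ := by
    rw [auxG_eq] at hx
    refine Submodule.span_le.2 ?_ hx
    rintro _ ⟨v, rfl⟩
    rw [auxT_succ]
    generalize auxT n (fun i => v i.succ) = z
    generalize v 0 = w
    have hw : w ∈ Submodule.span ℂ (Set.range b) := by rw [b.span_eq]; trivial
    induction hw using Submodule.span_induction with
    | zero => simp
    | add w w' _ _ h h' => rw [map_add, add_mul]; exact Submodule.add_mem _ h h'
    | smul c w _ h => rw [map_smul, smul_mul_assoc]; exact Submodule.smul_mem _ c h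
    | mem w h =>
      obtain ⟨i, rfl⟩ := h
      exact ⟨Finsupp.single i z, by simp [Φ]⟩
  obtain ⟨y, rfl⟩ := hr
  have : y = 0 := by
    ext i
    rw [← hΦ, h]; simp
  simp [this]

theorem IsLieElem.pos {i : ℕ} {x : TensorAlgebra ℂ V} (h : IsLieElem V i x) : 1 ≤ i := by
  induction h with
  | base => rfl
  | bracket _ _ h1 h2 => omega

theorem IsLieElem.mem {i : ℕ} {x : TensorAlgebra ℂ V} (h : IsLieElem V i x) : x ∈ auxG V i := by
  induction h with
  | base v => simp [auxG]
  | @bracket a b x y _ _ h1 h2 =>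
    refine Submodule.sub_mem _ ?_ ?_
    · rw [auxG, pow_add]; exact Submodule.mul_mem_mul h1 h2
    · rw [auxG, add_comm, pow_add]; exact Submodule.mul_mem_mul h2 h1

theorem IsLieElem.scalar (f : V →ₗ[ℂ] ℂ) {i : ℕ} {x : TensorAlgebra ℂ V}
    (h : IsLieElem V i x) :
    (∃ c, auxD f x = algebraMap ℂ _ c) ∧ (2 ≤ i → auxD f x = 0) := by
  induction h with
  | base v => exact ⟨⟨f v, auxD_ι f v⟩, by omega⟩
  | @bracket a b x y _ _ h1 h2 =>
    obtain ⟨⟨c, hc⟩, -⟩ := h1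
    obtain ⟨⟨d, hd⟩, -⟩ := h2
    have : auxD f (x * y - y * x) = 0 := by
      rw [map_sub, auxD_mul, auxD_mul, hc, hd, ← Algebra.commutes c y, ← Algebra.commutes d x]
      abel
    exact ⟨⟨0, by simp [this]⟩, fun _ => this⟩

theorem lieGrade_le (i : ℕ) : lieGrade V i ≤ auxG V i :=
  Submodule.span_le.2 fun _ h => IsLieElem.mem h

theorem lieGrade_D (f : V →ₗ[ℂ] ℂ) (i : ℕ) (hi : 2 ≤ i) (x : TensorAlgebra ℂ V)
    (hx : x ∈ lieGrade V i) : auxD f x = 0 := by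
  have : lieGrade V i ≤ LinearMap.ker (auxD f) :=
    Submodule.span_le.2 fun _ h => (IsLieElem.scalar f h).2 hi
  exact this hx

theorem lieGrade_one (x : TensorAlgebra ℂ V) (hx : x ∈ lieGrade V 1) : ∃ v, x = ι ℂ v := by
  have := lieGrade_le 1 hx
  rw [auxG, pow_one] at this
  obtain ⟨v, hv⟩ := this
  exact ⟨v, hv.symm⟩

theorem comp_sum {A : Type*} [AddCommMonoid A] (m : ℕ) (F : List ℕ → A) :
    ∑ c : Composition (m+1), F c.blocks =
      ∑ i ∈ Finset.range (m+1), ∑ c : Composition (m - i), F ((i+1) :: c.blocks) := by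
  rw [Finset.sum_sigma']
  symm
  refine Finset.sum_bij (fun p hp => (⟨(p.1+1) :: p.2.blocks, ?_, ?_⟩ : Composition (m+1)))
    ?_ ?_ ?_ ?_
  · intro i hi
    rcases List.mem_cons.1 hi with h | h
    · omega
    · exact p.2.blocks_pos h
  · have := Finset.mem_range.1 (Finset.mem_sigma.1 hp).1
    rw [List.sum_cons, p.2.blocks_sum]
    omega
  · intros; simp
  · rintro ⟨i, c⟩ hi ⟨j, d⟩ hj h
    simp only [Composition.mk.injEq, List.cons.injEq, Nat.add_right_cancel_iff] at h
    obtain ⟨rfl, h⟩ := h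
    have : c = d := Composition.ext h
    rw [this]
  · rintro ⟨l, hl, hs⟩ -
    cases l with
    | nil => simp at hs
    | cons a l =>
      have ha : 0 < a := hl (by simp)
      rw [List.sum_cons] at hs
      obtain ⟨a, rfl⟩ : ∃ a', a = a' + 1 := ⟨a - 1, by omega⟩
      refine ⟨⟨a, ⟨l, fun h => hl (by simp [h]), by omega⟩⟩, ?_, rfl⟩
      simp; omega
  · intros; rfl

/-- weighted version of phi -/
noncomputable def auxΦ (T : ℕ → TensorAlgebra ℂ V) (w : ℕ → ℂ) (m : ℕ) : TensorAlgebra ℂ V :=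
  ∑ c : Composition m, w c.length • (c.blocks.map T).prod

theorem auxΦ_zero (T : ℕ → TensorAlgebra ℂ V) (w : ℕ → ℂ) :
    auxΦ T w 0 = algebraMap ℂ _ (w 0) := by
  have : ∀ c : Composition 0, c.blocks = [] := by
    intro c
    have := c.blocks_sum
    rcases h : c.blocks with _ | ⟨a, l⟩
    · rfl
    · have h1 := c.blocks_pos (i := a) (by simp [h])
      rw [h, List.sum_cons] at this
      omega
  have h2 : Fintype.card (Composition 0) = 1 := composition_card 0
  simp [auxΦ, Composition.length, this, h2, Algebra.smul_def]

theorem auxΦ_succ (T : ℕ → TensorAlgebra ℂ V) (w : ℕ → ℂ) (m : ℕ) :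
    auxΦ T w (m+1) =
      ∑ i ∈ Finset.range (m+1), T (i+1) * auxΦ T (fun l => w (l+1)) (m - i) := by
  have := comp_sum m (fun l => w l.length • (l.map T).prod)
  rw [auxΦ]
  simp only [Composition.length]
  rw [this]
  simp [auxΦ, Finset.mul_sum, Composition.length]

theorem auxΦ_add (T : ℕ → TensorAlgebra ℂ V) (w u : ℕ → ℂ) (m : ℕ) :
    auxΦ T w m + auxΦ T u m = auxΦ T (fun l => w l + u l) m := by
  simp [auxΦ, ← Finset.sum_add_distrib, add_smul]

theorem auxΦ_mem (T : ℕ → TensorAlgebra ℂ V) (k : ℕ)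
    (hT : ∀ i, 1 ≤ i → i ≤ k → T i ∈ lieGrade V i) (m : ℕ) :
    ∀ w, m ≤ k → auxΦ T w m ∈ auxG V m := by
  induction m using Nat.strong_induction_on with
  | _ m ih =>
  intro w hm
  cases m with
  | zero => rw [auxΦ_zero, auxG, pow_zero]; exact Submodule.algebraMap_mem _
  | succ m =>
    rw [auxΦ_succ]
    refine Submodule.sum_mem _ fun i hi => ?_
    have hi := Finset.mem_range.1 hi
    rw [show m + 1 = (i + 1) + (m - i) by omega, auxG, pow_add]
    exact Submodule.mul_mem_mul (lieGrade_le _ (hT (i+1) (by omega) (by omega)))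
      (ih (m-i) (by omega) _ (by omega))

theorem auxD_auxΦ (f : V →ₗ[ℂ] ℂ) (T : ℕ → TensorAlgebra ℂ V) (k : ℕ) (c : ℂ)
    (h1 : auxD f (T 1) = algebraMap ℂ _ c)
    (hT : ∀ i, 2 ≤ i → i ≤ k → auxD f (T i) = 0) (m : ℕ) :
    ∀ w, m + 1 ≤ k → auxD f (auxΦ T w (m+1)) =
      c • auxΦ T (fun l => ((l : ℂ) + 1) * w (l+1)) m := by
  induction m using Nat.strong_induction_on with
  | _ m ih =>
  intro w hm
  rw [auxΦ_succ, map_sum]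
  simp only [auxD_mul, Finset.sum_add_distrib]
  have e1 : ∑ i ∈ Finset.range (m+1), auxD f (T (i+1)) * auxΦ T (fun l => w (l+1)) (m - i)
      = c • auxΦ T (fun l => w (l+1)) m := by
    rw [Finset.sum_range_succ', Finset.sum_eq_zero]
    · simp [h1, Algebra.smul_def]
    · intro i hi
      have hi := Finset.mem_range.1 hi
      rw [hT _ (by omega) (by omega), zero_mul]
  have e2 : ∑ i ∈ Finset.range (m+1), T (i+1) * auxD f (auxΦ T (fun l => w (l+1)) (m - i))
      = c • auxΦ T (fun l => (l : ℂ) * w (l+1)) m := by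
    rw [Finset.sum_range_succ, Nat.sub_self, auxΦ_zero, auxD_algebraMap, mul_zero, add_zero]
    cases m with
    | zero => simp [auxΦ_zero]
    | succ m =>
      rw [auxΦ_succ, Finset.smul_sum]
      refine Finset.sum_congr rfl fun i hi => ?_
      have hi := Finset.mem_range.1 hi
      rw [show m + 1 - i = (m - i) + 1 by omega, ih (m - i) (by omega) _ (by omega)]
      simp
  rw [e1, e2, ← smul_add, auxΦ_add]
  congr 2
  ext l; ring

theorem auxΦ_pow (T : ℕ → TensorAlgebra ℂ V) (m : ℕ) :
    ∀ w, (∀ i, 2 ≤ i → i ≤ m → T i = 0) → auxΦ T w m = w m • T 1 ^ m := by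
  induction m with
  | zero => intro w _; simp [auxΦ_zero, Algebra.smul_def]
  | succ m ih =>
    intro w h
    rw [auxΦ_succ, Finset.sum_range_succ', Finset.sum_eq_zero]
    · simp only [zero_add, Nat.sub_zero]
      rw [ih _ (fun i hi hi' => h i hi (by omega)), pow_succ']
      simp
    · intro i hi
      have hi := Finset.mem_range.1 hi
      rw [h _ (by omega) (by omega), zero_mul]

theorem phi_eq (T : ℕ → TensorAlgebra ℂ V) (m : ℕ) :
    phiTA V m T = auxΦ T (fun l => (l.factorial : ℂ)⁻¹) m := rfl

theorem phi_mem (T : ℕ → TensorAlgebra ℂ V) (k : ℕ)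
    (hT : ∀ i, 1 ≤ i → i ≤ k → T i ∈ lieGrade V i) (m : ℕ) (hm : m ≤ k) :
    phiTA V m T ∈ auxG V m := by
  rw [phi_eq]
  exact auxΦ_mem T k hT m _ hm

theorem D_phi (f : V →ₗ[ℂ] ℂ) (T : ℕ → TensorAlgebra ℂ V) (k : ℕ) (c : ℂ)
    (h1 : auxD f (T 1) = algebraMap ℂ _ c)
    (hT : ∀ i, 2 ≤ i → i ≤ k → auxD f (T i) = 0) (m : ℕ) (hm : m + 1 ≤ k) :
    auxD f (phiTA V (m+1) T) = c • phiTA V m T := by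
  rw [phi_eq, phi_eq, auxD_auxΦ f T k c h1 hT m _ hm]
  congr 2
  ext l
  have : (l : ℂ) + 1 ≠ 0 := by exact_mod_cast Nat.succ_ne_zero l
  rw [Nat.factorial_succ]
  push_cast
  field_simp

theorem phi_step (T : ℕ → TensorAlgebra ℂ V) (k : ℕ)
    (hT : ∀ i, 1 ≤ i → i ≤ k → T i ∈ lieGrade V i)
    (hT1 : T 1 ≠ 0)
    (hsymm : IsSymmetricAt V k (phiTA V k T)) (m : ℕ) (hm : m + 1 ≤ k) :
    ((m : ℂ) + 1) • phiTA V (m+1) T = T 1 * phiTA V m T := by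
  obtain ⟨v, hv⟩ := lieGrade_one _ (hT 1 le_rfl (by omega))
  have hD : ∀ (f : V →ₗ[ℂ] ℂ) m, m + 1 ≤ k →
      auxD f (phiTA V (m+1) T) = f v • phiTA V m T := fun f m hm =>
    D_phi f T k (f v) (by rw [hv, auxD_ι])
      (fun i h2 hk => lieGrade_D f i h2 _ (hT i (by omega) hk)) m hm
  have hv0 : v ≠ 0 := by rintro rfl; simp [hv] at hT1
  obtain ⟨f, hf⟩ : ∃ f : V →ₗ[ℂ] ℂ, f v = 1 := by
    obtain ⟨g, hg⟩ : ∃ g : Module.Dual ℂ V, g v ≠ 0 := by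
      by_contra! hcon
      exact hv0 ((Module.forall_dual_apply_eq_zero_iff ℂ v).1 hcon)
    exact ⟨(g v)⁻¹ • g, by simp [hg]⟩
  obtain ⟨d, hd⟩ : ∃ d, k = m + 1 + d := ⟨k - (m+1), by omega⟩
  induction d generalizing m with
  | zero =>
    obtain rfl : k = m + 1 := hd
    rw [← sub_eq_zero]
    refine auxC_sep m _ ?_ ?_
    · refine Submodule.sub_mem _ (Submodule.smul_mem _ _ (phi_mem T _ hT _ le_rfl)) ?_
      rw [auxG, pow_succ']
      refine Submodule.mul_mem_mul ?_ (phi_mem T _ hT _ (by omega))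
      rw [hv]; exact LinearMap.mem_range_self _ _
    · intro g
      rw [map_sub, map_smul, ← auxD_symm g m _ (phi_mem T _ hT _ le_rfl) hsymm,
        hD g m le_rfl, hv, auxC_ι_mul, sub_self]
  | succ d ih =>
    have h := congrArg (auxD f) (ih (m+1) (by omega) (by omega))
    rw [map_smul, hD f _ (by omega), auxD_mul, hD f _ hm, hv, auxD_ι, hf, one_smul, one_smul,
      map_one, one_mul] at h
    rw [hv]
    push_cast at h
    rw [add_smul, one_smul, add_comm] at h
    exact add_left_cancel h

theorem phi_formula (T : ℕ → TensorAlgebra ℂ V) (k : ℕ)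
    (h : ∀ m, m + 1 ≤ k → ((m : ℂ) + 1) • phiTA V (m+1) T = T 1 * phiTA V m T)
    (m : ℕ) (hm : m ≤ k) : phiTA V m T = ((m.factorial : ℂ))⁻¹ • T 1 ^ m := by
  induction m with
  | zero => rw [phi_eq, auxΦ_zero]; simp
  | succ m ih =>
    have h' := h m hm
    have h0 : (m : ℂ) + 1 ≠ 0 := by exact_mod_cast Nat.succ_ne_zero m
    rw [ih (by omega), mul_smul_comm, ← pow_succ'] at h'
    rw [← inv_smul_smul₀ h0 (phiTA V (m+1) T), h', smul_smul, Nat.factorial_succ]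
    push_cast
    rw [mul_inv]

theorem sym_pow (v : V) (i : ℕ) (c : ℂ) : IsSymmetricAt V i (c • (ι ℂ v) ^ i) := by
  intro σ P hP
  have := hP (fun _ => v)
  simp only [List.ofFn_const, List.prod_replicate] at this
  rw [map_smul, this]

end Aux

/-- Let `k ≥ 2`, `T_i ∈ Lie^i V` for `1 ≤ i ≤ k` with
`T₁ ≠ 0`.  If the signature tensor `φ_k(T₁,…,T_k)` is symmetric, then `T_i = 0`
for all `2 ≤ i ≤ k`, and consequently `φ_i(T₁,…,T_i) = (1/i!)·T₁^{⊗i}` is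
symmetric for every `1 ≤ i ≤ k`. -/
theorem symmetric_signature_lower_levels (k : ℕ) (hk : 2 ≤ k)
    (T : ℕ → TensorAlgebra ℂ V)
    (hT : ∀ i, 1 ≤ i → i ≤ k → T i ∈ lieGrade V i)
    (hT1 : T 1 ≠ 0)
    (hsymm : IsSymmetricAt V k (phiTA V k T)) :
    (∀ i, 2 ≤ i → i ≤ k → T i = 0) ∧
    (∀ i, 1 ≤ i → i ≤ k →
      phiTA V i T = ((i.factorial : ℂ))⁻¹ • T 1 ^ i ∧
      IsSymmetricAt V i (phiTA V i T)) := by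
  have hform := phi_formula T k (phi_step T k hT hT1 hsymm)
  obtain ⟨v, hv⟩ := lieGrade_one _ (hT 1 le_rfl (by omega))
  refine ⟨?_, fun i _ hi => ⟨hform i hi, ?_⟩⟩
  · intro i
    induction i using Nat.strong_induction_on with
    | _ i ih =>
    intro h2 hi
    obtain ⟨n, rfl⟩ : ∃ n, i = n + 2 := ⟨i - 2, by omega⟩
    have h := hform (n+2) hi
    rw [phi_eq, auxΦ_succ, Finset.sum_range_succ, Finset.sum_range_succ',
      Finset.sum_eq_zero] at h
    · simp only [zero_add, Nat.sub_zero, Nat.sub_self] at h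
      rw [auxΦ_pow T (n+1) _ (fun j hj hj' => ih j (by omega) hj (by omega)), auxΦ_zero,
        mul_smul_comm, ← pow_succ'] at h
      simpa using h
    · intro j hj
      have hj := Finset.mem_range.1 hj
      rw [ih _ (by omega) (by omega) (by omega), zero_mul]
  · rw [hform i hi, hv]
    exact sym_pow v i _
end

section
/- Let d = 2e be even. Define the Pfaffian-type polynomial P(A) = Σ_{σ ∈ S_d} sgn(σ) · Π_{i=1}^{e} A_{σ(2i−1),σ(2i)} on skew-symmetric d×d complex matrices. Then (i) P is SL_d(ℂ)-invariant: P(g A gᵀ) = P(A) for all g ∈ SL_d(ℂ); and (ii) every polynomial function f(v, A) on pairs (v, A) ∈ ℂ^d × {skew-symmetric d×d complex matrices} satisfying f(g v, g A gᵀ) = f(v, A) for all g ∈ SL_d(ℂ) is a polynomial in P(A) alone; moreover P is non-constant, so this invariant ring is a univariate polynomial ring generated by P. -/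
open Matrix

/-- The Pfaffian-type polynomial
`P(A) = Σ_{σ ∈ S_d} sgn(σ) · Π_{i=1}^{e} A_{σ(2i−1), σ(2i)}` (written with
`0`-based indices) on `d × d` matrices, where `d = 2e`. -/
noncomputable def pfafP (e : ℕ) (A : Matrix (Fin (2 * e)) (Fin (2 * e)) ℂ) : ℂ :=
  ∑ σ : Equiv.Perm (Fin (2 * e)),
    ((Equiv.Perm.sign σ : ℤ) : ℂ) *
      ∏ i : Fin e,
        A (σ ⟨2 * i.val, by have := i.2; omega⟩) (σ ⟨2 * i.val + 1, by have := i.2; omega⟩)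



abbrev NI (e : ℕ) := Fin 2 × Fin e

def phiEquiv (e : ℕ) : NI e ≃ Fin (2 * e) :=
  ((Equiv.prodComm _ _).trans finProdFinEquiv).trans (finCongr (Nat.mul_comm e 2))

noncomputable def pf2 (e : ℕ) (A : Matrix (NI e) (NI e) ℂ) : ℂ :=
  ∑ σ : Equiv.Perm (NI e), ((Equiv.Perm.sign σ : ℤ) : ℂ) * ∏ i : Fin e, A (σ (0, i)) (σ (1, i))

theorem pfafP_eq (e : ℕ) (A : Matrix (Fin (2 * e)) (Fin (2 * e)) ℂ) :
    pfafP e A = pf2 e (A.submatrix (phiEquiv e) (phiEquiv e)) := by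
  unfold pfafP pf2
  symm
  refine Fintype.sum_equiv (phiEquiv e).permCongr _ _ ?_
  intro σ
  rw [Equiv.Perm.sign_permCongr]
  congr 1
  refine Finset.prod_congr rfl fun i _ => ?_
  have h0 : (⟨2 * i.val, by have := i.2; omega⟩ : Fin (2 * e)) = phiEquiv e (0, i) := by
    ext; simp [phiEquiv, finProdFinEquiv]
  have h1 : (⟨2 * i.val + 1, by have := i.2; omega⟩ : Fin (2 * e)) = phiEquiv e (1, i) := by
    ext; simp [phiEquiv, finProdFinEquiv]; omega
  rw [h0, h1]
  simp [Equiv.permCongr_apply]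

theorem det_sub_fun (e : ℕ) (g : Matrix (NI e) (NI e) ℂ) (φ : NI e → NI e) :
    (∑ σ : Equiv.Perm (NI e), ((Equiv.Perm.sign σ : ℤ) : ℂ) * ∏ l, g (σ l) (φ l)) =
      (g.submatrix id φ).det := by
  rw [Matrix.det_apply']; rfl

theorem pf2_mul (e : ℕ) (g A : Matrix (NI e) (NI e) ℂ) :
    pf2 e (g * A * gᵀ) = g.det * pf2 e A := by
  have h1 : ∀ σ : Equiv.Perm (NI e), ∏ i : Fin e, (g * A * gᵀ) (σ (0, i)) (σ (1, i)) =
      ∑ φ : NI e → NI e, (∏ l, g (σ l) (φ l)) * ∏ i : Fin e, A (φ (0, i)) (φ (1, i)) := by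
    intro σ
    have : ∀ i : Fin e, (g * A * gᵀ) (σ (0, i)) (σ (1, i)) =
        ∑ ψ : Fin 2 → NI e, g (σ (0, i)) (ψ 0) * g (σ (1, i)) (ψ 1) * A (ψ 0) (ψ 1) := by
      intro i
      rw [← (finTwoArrowEquiv (NI e)).symm.sum_comp, Fintype.sum_prod_type]
      simp only [Matrix.mul_apply, Matrix.transpose_apply, Finset.sum_mul]
      rw [Finset.sum_comm]
      refine Finset.sum_congr rfl fun x _ => Finset.sum_congr rfl fun y _ => ?_
      simp [finTwoArrowEquiv]; ring
    rw [Finset.prod_congr rfl fun i _ => this i, Finset.prod_univ_sum, Fintype.piFinset_univ]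
    refine Fintype.sum_equiv (((Equiv.curry (Fin e) (Fin 2) (NI e)).symm).trans
      ((Equiv.prodComm (Fin e) (Fin 2)).arrowCongr (Equiv.refl _))) _ _ ?_
    intro ψ
    simp only [Finset.prod_mul_distrib, Fintype.prod_prod_type, Fin.prod_univ_two]
    rfl
  unfold pf2
  simp only [h1, Finset.mul_sum]
  rw [Finset.sum_comm]
  have h2 : ∀ φ : NI e → NI e, (∑ σ : Equiv.Perm (NI e), ((Equiv.Perm.sign σ : ℤ) : ℂ) *
      ((∏ l, g (σ l) (φ l)) * ∏ i : Fin e, A (φ (0, i)) (φ (1, i)))) =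
      (g.submatrix id φ).det * ∏ i : Fin e, A (φ (0, i)) (φ (1, i)) := by
    intro φ
    rw [← det_sub_fun, Finset.sum_mul]
    exact Finset.sum_congr rfl fun _ _ => by ring
  simp only [h2]
  symm
  refine Finset.sum_of_injOn (fun σ : Equiv.Perm (NI e) => (σ : NI e → NI e)) ?_ ?_ ?_ ?_
  · intro a _ b _ h
    exact DFunLike.coe_injective h
  · intro _ _; simp
  · intro φ _ hφ
    have : ¬ Function.Injective φ := by
      intro hinj
      apply hφ
      exact ⟨Equiv.ofBijective φ (Finite.injective_iff_bijective.1 hinj), by simp, rfl⟩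
    rw [Function.not_injective_iff] at this
    obtain ⟨a, b, hab, hne⟩ := this
    rw [Matrix.det_zero_of_column_eq hne, zero_mul]
    intro k; simp [hab]
  · intro σ _
    rw [Matrix.det_permute']
    ring

def eps : Matrix (Fin 2) (Fin 2) ℂ := !![0, 1; -1, 0]

theorem eps_mul (B : Matrix (Fin 2) (Fin 2) ℂ) : B * eps * Bᵀ = B.det • eps := by
  rw [Matrix.det_fin_two]
  ext i j
  fin_cases i <;> fin_cases j <;>
    simp [eps, Matrix.mul_apply, Fin.sum_univ_two] <;> ring


def JJ (e : ℕ) : Matrix (NI e) (NI e) ℂ := Matrix.blockDiagonal fun _ => eps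

theorem JJ_apply (e : ℕ) (a b : Fin 2) (i j : Fin e) :
    JJ e (a, i) (b, j) = if i = j then eps a b else 0 := by
  simp [JJ, Matrix.blockDiagonal_apply]

theorem eps_transpose : epsᵀ = -eps := by
  ext i j
  fin_cases i <;> fin_cases j <;> simp [eps]

theorem JJ_transpose (e : ℕ) : (JJ e)ᵀ = -JJ e := by
  unfold JJ
  rw [Matrix.blockDiagonal_transpose, ← Matrix.blockDiagonal_neg, eps_transpose]
  rfl

theorem JJ_det (e : ℕ) : (JJ e).det = 1 := by
  simp [JJ, Matrix.det_blockDiagonal, eps, Matrix.det_fin_two]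

/-- every term in the Pfaffian sum of the standard form is 0 or 1 -/
theorem pf_term (e : ℕ) (σ : Equiv.Perm (NI e)) :
    ((Equiv.Perm.sign σ : ℤ) : ℂ) * ∏ i : Fin e, JJ e (σ (0, i)) (σ (1, i)) = 0 ∨
    ((Equiv.Perm.sign σ : ℤ) : ℂ) * ∏ i : Fin e, JJ e (σ (0, i)) (σ (1, i)) = 1 := by
  by_cases h : ∀ i : Fin e, JJ e (σ (0, i)) (σ (1, i)) ≠ 0
  · right
    have h1 : ∀ i, (σ (0, i)).2 = (σ (1, i)).2 := by
      intro i
      by_contra hne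
      exact h i (by
        have := JJ_apply e (σ (0, i)).1 (σ (1, i)).1 (σ (0, i)).2 (σ (1, i)).2
        rw [if_neg hne] at this
        exact this)
    have h2 : ∀ i, (σ (0, i)).1 ≠ (σ (1, i)).1 := by
      intro i hE
      have : σ (0, i) = σ (1, i) := Prod.ext hE (h1 i)
      simpa using σ.injective this
    let s : Fin e → Equiv.Perm (Fin 2) := fun i => if (σ (0, i)).1 = 0 then 1 else Equiv.swap 0 1
    let τ0 : Fin e → Fin e := fun i => (σ (0, i)).2
    have hσ : ∀ a i, σ (a, i) = (s i a, τ0 i) := by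
      intro a i
      refine Prod.ext ?_ ?_
      · have := h2 i
        simp only [s]
        split_ifs with h0
        · fin_cases a
          · simpa using h0
          · simp only [Fin.mk_one, Equiv.Perm.coe_one, id]; omega
        · fin_cases a
          · simp; omega
          · simp; omega
      · fin_cases a
        · rfl
        · exact (h1 i).symm
    have hτ : Function.Bijective τ0 := by
      rw [← Finite.surjective_iff_bijective]
      intro j
      obtain ⟨⟨a, i⟩, hai⟩ := σ.surjective (0, j)
      refine ⟨i, ?_⟩
      rw [hσ] at hai
      exact congrArg Prod.snd hai
    let τ := Equiv.ofBijective τ0 hτ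
    have hfac : σ = Equiv.prodCongrRight (fun _ : Fin 2 => τ) * Equiv.prodCongrLeft s := by
      ext1 ⟨a, i⟩
      rw [hσ]
      rfl
    have hs : Equiv.Perm.sign σ = ∏ i, Equiv.Perm.sign (s i) := by
      conv_lhs => rw [hfac]
      rw [Equiv.Perm.sign_mul, Equiv.Perm.sign_prodCongrRight, Equiv.Perm.sign_prodCongrLeft]
      simp
    have hJ : ∀ i, JJ e (σ (0, i)) (σ (1, i)) = ((Equiv.Perm.sign (s i) : ℤ) : ℂ) := by
      intro i
      rw [hσ, hσ, JJ_apply, if_pos rfl]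
      simp only [s]
      split_ifs <;> simp [eps]
    rw [hs]
    simp only [hJ]
    push_cast
    rw [← Finset.prod_mul_distrib]
    refine Finset.prod_eq_one fun i _ => ?_
    rcases Int.units_eq_one_or (Equiv.Perm.sign (s i)) with h | h <;> simp [h]
  · left
    push Not at h
    obtain ⟨i, hi⟩ := h
    rw [Finset.prod_eq_zero (Finset.mem_univ i) hi, mul_zero]

theorem pf2_JJ (e : ℕ) : pf2 e (JJ e) ≠ 0 := by
  intro h
  have h2 := congrArg Complex.re h
  unfold pf2 at h2
  rw [Complex.re_sum, Complex.zero_re, Finset.sum_eq_zero_iff_of_nonneg] at h2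
  · have := h2 1 (Finset.mem_univ _)
    simp [JJ_apply, eps] at this
  · intro σ _
    rcases pf_term e σ with h | h <;> rw [h] <;> simp

/-- symplectic families -/
theorem exists_family {n : Type*} [Fintype n] [DecidableEq n] (A : Matrix n n ℂ)
    (hA : Aᵀ = -A) (hd : A.det ≠ 0) (k : ℕ) (hk : 2 * k ≤ Fintype.card n) :
    ∃ p q : Fin k → n → ℂ, (∀ i j, p i ⬝ᵥ A *ᵥ p j = 0) ∧ (∀ i j, q i ⬝ᵥ A *ᵥ q j = 0) ∧
      (∀ i j, p i ⬝ᵥ A *ᵥ q j = if i = j then 1 else 0) := by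
  have skew : ∀ x y : n → ℂ, x ⬝ᵥ A *ᵥ y = - (y ⬝ᵥ A *ᵥ x) := by
    intro x y
    rw [Matrix.dotProduct_mulVec, ← Matrix.mulVec_transpose, hA, Matrix.neg_mulVec,
      neg_dotProduct, dotProduct_comm]
  have self : ∀ x : n → ℂ, x ⬝ᵥ A *ᵥ x = 0 := by
    intro x
    have := skew x x
    linear_combination (1/2 : ℂ) * this
  induction k with
  | zero => exact ⟨fun _ => 0, fun _ => 0, fun i => i.elim0, fun i => i.elim0, fun i => i.elim0⟩
  | succ k ih =>
    obtain ⟨p, q, hp, hq, hpq⟩ := ih (by omega)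
    -- a nonzero vector orthogonal to everything
    let T : (n → ℂ) →ₗ[ℂ] (Fin k ⊕ Fin k → ℂ) :=
      (Matrix.of (Sum.elim (fun i => p i ᵥ* A) (fun i => q i ᵥ* A))).mulVecLin
    have hT : ∃ u, u ≠ 0 ∧ T u = 0 := by
      by_contra hcon
      push Not at hcon
      have hinj : Function.Injective T := by
        rw [injective_iff_map_eq_zero]
        intro a ha
        by_contra h0
        exact hcon a h0 ha
      have := LinearMap.finrank_le_finrank_of_injective hinj
      simp at this
      omega
    obtain ⟨u, hu0, hu⟩ := hT
    have hup : ∀ i, p i ⬝ᵥ A *ᵥ u = 0 := fun i => by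
      have := congrFun hu (Sum.inl i)
      rw [Matrix.dotProduct_mulVec]
      exact this
    have huq : ∀ i, q i ⬝ᵥ A *ᵥ u = 0 := fun i => by
      have := congrFun hu (Sum.inr i)
      rw [Matrix.dotProduct_mulVec]
      exact this
    have hw : ∃ w, u ⬝ᵥ A *ᵥ w = 1 := by
      by_contra hcon
      apply hu0
      have hz : u ᵥ* A = 0 := by
        ext j
        by_contra hj
        apply hcon
        refine ⟨Pi.single j ((u ᵥ* A) j)⁻¹, ?_⟩
        rw [Matrix.dotProduct_mulVec, dotProduct_single]
        exact mul_inv_cancel₀ hj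
      exact Matrix.eq_zero_of_vecMul_eq_zero hd hz
    obtain ⟨w, hw⟩ := hw
    let w' : n → ℂ := w + ∑ i, (q i ⬝ᵥ A *ᵥ w) • p i - ∑ i, (p i ⬝ᵥ A *ᵥ w) • q i
    have exp : ∀ x, x ⬝ᵥ A *ᵥ w' = x ⬝ᵥ A *ᵥ w + ∑ i, (q i ⬝ᵥ A *ᵥ w) * (x ⬝ᵥ A *ᵥ p i)
        - ∑ i, (p i ⬝ᵥ A *ᵥ w) * (x ⬝ᵥ A *ᵥ q i) := by
      intro x
      simp only [w', Matrix.mulVec_sub, Matrix.mulVec_add, dotProduct_sub, dotProduct_add,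
        Matrix.mulVec_sum, Matrix.mulVec_smul, dotProduct_sum, dotProduct_smul, smul_eq_mul]
    have hqp : ∀ i j, q i ⬝ᵥ A *ᵥ p j = if i = j then -1 else 0 := by
      intro i j
      rw [skew, hpq]
      by_cases h : i = j
      · simp [h]
      · simp [h, Ne.symm h]
    have hpw : ∀ i, p i ⬝ᵥ A *ᵥ w' = 0 := by
      intro i; rw [exp]; simp [hp, hpq]
    have hqw : ∀ i, q i ⬝ᵥ A *ᵥ w' = 0 := by
      intro i; rw [exp]; simp [hq, hqp]
    have huw : u ⬝ᵥ A *ᵥ w' = 1 := by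
      rw [exp, hw]
      simp [skew u, hup, huq]
    refine ⟨Fin.snoc p u, Fin.snoc q w', ?_, ?_, ?_⟩
    · intro i j
      refine Fin.lastCases ?_ (fun i => ?_) i <;> refine Fin.lastCases ?_ (fun j => ?_) j
      · simp [self]
      · simp [skew u, hup]
      · simp [hup]
      · simp [hp]
    · intro i j
      refine Fin.lastCases ?_ (fun i => ?_) i <;> refine Fin.lastCases ?_ (fun j => ?_) j
      · simp [self]
      · simp [skew w', hqw]
      · simp [hqw]
      · simp [hq]
    · intro i j
      refine Fin.lastCases ?_ (fun i => ?_) i <;> refine Fin.lastCases ?_ (fun j => ?_) j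
      · simp [huw]
      · simp [skew u, huq, Fin.ext_iff]; omega
      · simp [hpw, Fin.ext_iff]; omega
      · simp [hpq]

theorem normal_form (e : ℕ) (A : Matrix (NI e) (NI e) ℂ) (hA : Aᵀ = -A) (hd : A.det ≠ 0) :
    ∃ g : Matrix (NI e) (NI e) ℂ, g.det ≠ 0 ∧ g * JJ e * gᵀ = A := by
  obtain ⟨p, q, hp, hq, hpq⟩ := exists_family A hA hd e (by simp)
  let h : Matrix (NI e) (NI e) ℂ := Matrix.of fun x => (if x.1 = 0 then p x.2 else q x.2)
  have hJ : h * A * hᵀ = JJ e := by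
    have key : ∀ x y, (h * A * hᵀ) x y = h x ⬝ᵥ A *ᵥ h y := by
      intro x y
      rw [Matrix.mul_assoc]
      rfl
    have hT : (h * A * hᵀ)ᵀ = - (h * A * hᵀ) := by
      simp [Matrix.transpose_mul, hA, Matrix.mul_assoc]
    have h0 : ∀ i, h (0, i) = p i := fun i => rfl
    have h1 : ∀ i, h (1, i) = q i := fun i => rfl
    ext ⟨a, i⟩ ⟨b, j⟩
    rw [JJ_apply]
    fin_cases a <;> fin_cases b
    · simp only [Fin.zero_eta, key, h0, hp]; simp [eps]
    · simp only [Fin.zero_eta, Fin.mk_one, key, h0, h1, hpq]; simp [eps]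
    · have := congrFun (congrFun hT (1, i)) (0, j)
      rw [Matrix.transpose_apply, Matrix.neg_apply, key, h0, h1, hpq] at this
      simp only [Fin.mk_one, Fin.zero_eta]
      rw [← neg_eq_iff_eq_neg.2 this]
      by_cases hij : i = j
      · simp [hij, eps]
      · simp [hij, Ne.symm hij]
    · simp only [Fin.mk_one, key, h1, hq]; simp [eps]
  have hdet : h.det * A.det * h.det = 1 := by
    have := congrArg Matrix.det hJ
    rwa [Matrix.det_mul, Matrix.det_mul, Matrix.det_transpose, JJ_det] at this
  have hh : h.det ≠ 0 := by
    intro h0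
    simp [h0] at hdet
  have hu : IsUnit h.det := isUnit_iff_ne_zero.2 hh
  refine ⟨h⁻¹, ?_, ?_⟩
  · rw [Matrix.det_nonsing_inv, Ring.inverse_eq_inv']
    exact inv_ne_zero hh
  · rw [← hJ, Matrix.transpose_nonsing_inv]
    have hut : IsUnit hᵀ.det := by rwa [Matrix.det_transpose]
    calc h⁻¹ * (h * A * hᵀ) * hᵀ⁻¹ = (h⁻¹ * h) * A * (hᵀ * hᵀ⁻¹) := by
          simp only [Matrix.mul_assoc]
      _ = A := by rw [Matrix.nonsing_inv_mul _ hu, Matrix.mul_nonsing_inv _ hut]; simp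

/-- block-diagonal scaled form -/
def JK (e : ℕ) (k : Fin e → ℂ) : Matrix (NI e) (NI e) ℂ :=
  Matrix.blockDiagonal fun i => k i • eps

theorem JK_one (e : ℕ) : JK e (fun _ => 1) = JJ e := by simp [JK, JJ]

theorem JK_transpose (e : ℕ) (k : Fin e → ℂ) : (JK e k)ᵀ = -JK e k := by
  unfold JK
  rw [Matrix.blockDiagonal_transpose, ← Matrix.blockDiagonal_neg]
  congr 1
  ext1 i
  simp [eps_transpose]

theorem bd_conj (e : ℕ) (B : Fin e → Matrix (Fin 2) (Fin 2) ℂ) (k : Fin e → ℂ) :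
    Matrix.blockDiagonal B * JK e k * (Matrix.blockDiagonal B)ᵀ =
      JK e (fun i => (B i).det * k i) := by
  unfold JK
  rw [Matrix.blockDiagonal_transpose, ← Matrix.blockDiagonal_mul, ← Matrix.blockDiagonal_mul]
  congr 1
  ext1 i
  rw [Matrix.mul_smul, Matrix.smul_mul, eps_mul, smul_smul, mul_comm]

theorem bd_mulVec (e : ℕ) (B : Fin e → Matrix (Fin 2) (Fin 2) ℂ) (w : NI e → ℂ)
    (a : Fin 2) (i : Fin e) :
    (Matrix.blockDiagonal B *ᵥ w) (a, i) = B i a 0 * w (0, i) + B i a 1 * w (1, i) := by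
  simp [Matrix.mulVec, dotProduct, Fintype.sum_prod_type, Matrix.blockDiagonal_apply, ite_mul]

theorem skew_conj {n : Type*} [Fintype n] (g A : Matrix n n ℂ) (hA : Aᵀ = -A) :
    (g * A * gᵀ)ᵀ = -(g * A * gᵀ) := by
  simp [Matrix.transpose_mul, hA, Matrix.mul_assoc]

theorem core (e : ℕ) (he : 1 ≤ e) (f : (NI e → ℂ) → Matrix (NI e) (NI e) ℂ → ℂ)
    (hc : Continuous fun x : (NI e → ℂ) × Matrix (NI e) (NI e) ℂ => f x.1 x.2)
    (hQ : ∀ A B, ∃ Q : Polynomial ℂ, ∀ t : ℂ, f 0 (A + t • B) = Q.eval t)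
    (hinv : ∀ g : Matrix (NI e) (NI e) ℂ, g.det = 1 → ∀ v A, Aᵀ = -A →
      f (g *ᵥ v) (g * A * gᵀ) = f v A) :
    ∃ Q : Polynomial ℂ, ∀ v A, Aᵀ = -A → f v A = Q.eval (pf2 e A) := by
  let i0 : Fin e := ⟨0, by omega⟩
  let kk : ℂ → Fin e → ℂ := fun c i => if i = i0 then c else 1
  let K := pf2 e (JJ e)
  have hK : K ≠ 0 := pf2_JJ e
  -- removing the vector
  have hvec0 : ∀ (k : Fin e → ℂ) (w : NI e → ℂ), (∀ i, w (1, i) = 0) →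
      f w (JK e k) = f 0 (JK e k) := by
    intro k w hw
    have hs : ∀ s : ℂ, s ∈ ({0}ᶜ : Set ℂ) → f (s • w) (JK e k) = f w (JK e k) := by
      intro s hs
      have hs0 : s ≠ 0 := hs
      let B : Fin e → Matrix (Fin 2) (Fin 2) ℂ := fun _ => !![s, 0; 0, s⁻¹]
      have hB : ∀ i, (B i).det = 1 := by
        intro i; simp [B, Matrix.det_fin_two, hs0]
      have := hinv (Matrix.blockDiagonal B) (by simp [Matrix.det_blockDiagonal, hB]) w
        (JK e k) (JK_transpose e k)
      rw [bd_conj] at this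
      simp only [hB, one_mul] at this
      rw [← this]
      congr 1
      ext ⟨a, i⟩
      rw [bd_mulVec]
      fin_cases a
      · simp [B]
      · simp [B, hw]
    have hcont : Continuous fun s : ℂ => f (s • w) (JK e k) :=
      hc.comp (by fun_prop : Continuous fun s : ℂ => (s • w, JK e k))
    have := Continuous.ext_on (dense_compl_singleton (0 : ℂ)) hcont
      (continuous_const (y := f w (JK e k))) hs
    have h0 := congrFun this 0
    simpa using h0.symm
  have hvec : ∀ (k : Fin e → ℂ) (w : NI e → ℂ), f w (JK e k) = f 0 (JK e k) := by
    intro k w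
    let B : Fin e → Matrix (Fin 2) (Fin 2) ℂ := fun i =>
      if w (0, i) = 0 then !![0, 1; -1, 0] else !![1, 0; -w (1, i) / w (0, i), 1]
    have hB : ∀ i, (B i).det = 1 := by
      intro i
      simp only [B]
      split_ifs <;> simp [Matrix.det_fin_two]
    have := hinv (Matrix.blockDiagonal B) (by simp [Matrix.det_blockDiagonal, hB]) w
      (JK e k) (JK_transpose e k)
    rw [bd_conj] at this
    simp only [hB, one_mul] at this
    rw [← this]
    apply hvec0
    intro i
    rw [bd_mulVec]
    simp only [B]
    split_ifs with h
    · simp [h]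
    · simp; field_simp; ring
  -- scaling matrices
  let D : ℂ → Matrix (NI e) (NI e) ℂ := fun c =>
    Matrix.blockDiagonal fun i => !![kk c i, 0; 0, 1]
  have hDdet : ∀ c, (D c).det = c := by
    intro c
    simp [D, Matrix.det_blockDiagonal, Matrix.det_fin_two, kk]
  have hDJ : ∀ c, D c * JJ e * (D c)ᵀ = JK e (kk c) := by
    intro c
    rw [← JK_one, bd_conj]
    congr 1
    ext1 i
    simp [Matrix.det_fin_two]
  obtain ⟨Q, hQ⟩ := hQ (JK e (kk 0)) (K⁻¹ • JK e (fun i => if i = i0 then 1 else 0))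
  have hQ' : ∀ t, f 0 (JK e (kk (t / K))) = Q.eval t := by
    intro t
    rw [← hQ]
    congr 1
    unfold JK
    rw [← Matrix.blockDiagonal_smul, ← Matrix.blockDiagonal_smul, ← Matrix.blockDiagonal_add]
    congr 1
    ext1 i
    by_cases hi : i = i0
    · simp [kk, hi, smul_smul, div_eq_mul_inv]
    · simp [kk, hi]
  have hnd : ∀ v A, Aᵀ = -A → A.det ≠ 0 → f v A = Q.eval (pf2 e A) := by
    intro v A hA hd
    obtain ⟨g, hg, hgA⟩ := normal_form e A hA hd
    have hP : pf2 e A = g.det * K := by rw [← hgA, pf2_mul]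
    have hDu : IsUnit (D g.det).det := by rw [hDdet]; exact isUnit_iff_ne_zero.2 hg
    let h := g * (D g.det)⁻¹
    have hh1 : h * D g.det = g := by
      simp only [h]
      rw [Matrix.mul_assoc, Matrix.nonsing_inv_mul _ hDu, Matrix.mul_one]
    have hhd : h.det = 1 := by
      have := congrArg Matrix.det hh1
      rw [Matrix.det_mul, hDdet] at this
      exact mul_right_cancel₀ hg (by rw [this, one_mul])
    have hhA : h * JK e (kk g.det) * hᵀ = A := by
      rw [← hgA, ← hDJ]
      conv_rhs => rw [← hh1]
      simp only [Matrix.transpose_mul, Matrix.mul_assoc]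
    have hhu : IsUnit h.det := by rw [hhd]; exact isUnit_one
    have := hinv h hhd (h⁻¹ *ᵥ v) (JK e (kk g.det)) (JK_transpose _ _)
    rw [hhA, Matrix.mulVec_mulVec, Matrix.mul_nonsing_inv _ hhu, Matrix.one_mulVec, hvec] at this
    rw [this, ← hQ', hP, mul_div_cancel_right₀ _ hK]
  refine ⟨Q, fun v A hA => ?_⟩
  have hpc : Continuous (pf2 e) := by unfold pf2; fun_prop
  -- density
  have hfin : {s : ℂ | (A + s • JJ e).det = 0}.Finite := by
    have hJu : IsUnit (JJ e).det := by rw [JJ_det]; exact isUnit_one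
    let M := -(A * (JJ e)⁻¹)
    have hM : ∀ s : ℂ, (A + s • JJ e).det = M.charpoly.eval s := by
      intro s
      rw [Matrix.eval_charpoly]
      have : A + s • JJ e = (Matrix.scalar (NI e) s - M) * JJ e := by
        simp only [M]
        rw [sub_neg_eq_add, Matrix.add_mul, Matrix.mul_assoc, Matrix.nonsing_inv_mul _ hJu,
          Matrix.mul_one, Matrix.scalar_apply, ← Matrix.smul_one_eq_diagonal, Matrix.smul_mul,
          Matrix.one_mul, add_comm]
      rw [this, Matrix.det_mul, JJ_det, mul_one]
    refine (Polynomial.finite_setOfPred_isRoot (p := M.charpoly) M.charpoly_monic.ne_zero).subset ?_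
    intro s hs
    rw [Set.mem_ofPred_eq, hM] at hs
    exact hs
  have hd := Set.Countable.dense_compl ℂ hfin.countable
  have hl : Continuous fun s : ℂ => f v (A + s • JJ e) :=
    hc.comp (by fun_prop : Continuous fun s : ℂ => (v, A + s • JJ e))
  have hr : Continuous fun s : ℂ => Q.eval (pf2 e (A + s • JJ e)) :=
    Q.continuous.comp (hpc.comp (by fun_prop))
  have := congrFun (Continuous.ext_on hd hl hr (fun s hs => hnd v _ (by
    rw [Matrix.transpose_add, Matrix.transpose_smul, hA, JJ_transpose, smul_neg, neg_add]) hs)) 0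
  simpa using this

theorem sub_conj (e : ℕ) (g A : Matrix (Fin (2 * e)) (Fin (2 * e)) ℂ) :
    (g * A * gᵀ).submatrix (phiEquiv e) (phiEquiv e) =
      g.submatrix (phiEquiv e) (phiEquiv e) * A.submatrix (phiEquiv e) (phiEquiv e) *
        (g.submatrix (phiEquiv e) (phiEquiv e))ᵀ := by
  rw [Matrix.transpose_submatrix, Matrix.submatrix_mul_equiv, Matrix.submatrix_mul_equiv]

theorem sub_conj' (e : ℕ) (g A : Matrix (NI e) (NI e) ℂ) :
    (g * A * gᵀ).submatrix (phiEquiv e).symm (phiEquiv e).symm =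
      g.submatrix (phiEquiv e).symm (phiEquiv e).symm *
        A.submatrix (phiEquiv e).symm (phiEquiv e).symm *
        (g.submatrix (phiEquiv e).symm (phiEquiv e).symm)ᵀ := by
  rw [Matrix.transpose_submatrix, Matrix.submatrix_mul_equiv, Matrix.submatrix_mul_equiv]

/-- For `d = 2e` even:
(i) `P` is `SL_d(ℂ)`-invariant on skew-symmetric matrices;
(ii) every polynomial function `f(v, A)` on `ℂ^d × {skew-symmetric matrices}`
that is invariant under the `SL_d(ℂ)`-action `g·(v,A) = (gv, gAgᵀ)` is a
polynomial in `P(A)` alone; and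
(iii) `P` is non-constant on skew-symmetric matrices, so the invariant ring
is a univariate polynomial ring generated by `P`. -/
theorem pfafP_generates_invariants (e : ℕ) (he : 1 ≤ e) :
    (∀ g : Matrix (Fin (2 * e)) (Fin (2 * e)) ℂ, g.det = 1 →
      ∀ A : Matrix (Fin (2 * e)) (Fin (2 * e)) ℂ, Aᵀ = -A →
        pfafP e (g * A * gᵀ) = pfafP e A) ∧
    (∀ f : (Fin (2 * e) → ℂ) → Matrix (Fin (2 * e)) (Fin (2 * e)) ℂ → ℂ,
      (∃ F : MvPolynomial (Fin (2 * e) ⊕ Fin (2 * e) × Fin (2 * e)) ℂ,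
        ∀ v A, f v A = MvPolynomial.eval (Sum.elim v fun p => A p.1 p.2) F) →
      (∀ g : Matrix (Fin (2 * e)) (Fin (2 * e)) ℂ, g.det = 1 →
        ∀ (v : Fin (2 * e) → ℂ) (A : Matrix (Fin (2 * e)) (Fin (2 * e)) ℂ), Aᵀ = -A →
          f (g.mulVec v) (g * A * gᵀ) = f v A) →
      ∃ Q : Polynomial ℂ, ∀ (v : Fin (2 * e) → ℂ)
          (A : Matrix (Fin (2 * e)) (Fin (2 * e)) ℂ), Aᵀ = -A →
        f v A = Q.eval (pfafP e A)) ∧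
    (∃ A B : Matrix (Fin (2 * e)) (Fin (2 * e)) ℂ,
      Aᵀ = -A ∧ Bᵀ = -B ∧ pfafP e A ≠ pfafP e B) := by
  refine ⟨?_, ?_, ?_⟩
  · intro g hg A _
    rw [pfafP_eq, pfafP_eq, sub_conj, pf2_mul, Matrix.det_submatrix_equiv_self, hg, one_mul]
  · rintro f ⟨F, hF⟩ hinv
    let ψ := (phiEquiv e).symm
    obtain ⟨Q, hQ⟩ := core e he (fun v A => f (v ∘ ψ) (A.submatrix ψ ψ)) (by
        simp only [hF]
        refine (MvPolynomial.continuous_eval F).comp ?_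
        refine continuous_pi fun i => ?_
        rcases i with i | i
        · simp only [Sum.elim_inl, Function.comp]; fun_prop
        · simp only [Sum.elim_inr, Matrix.submatrix_apply]; fun_prop) (by
        intro A B
        refine ⟨MvPolynomial.aeval (Sum.elim (fun _ => 0) (fun p =>
          Polynomial.C (A (ψ p.1) (ψ p.2)) + Polynomial.X * Polynomial.C (B (ψ p.1) (ψ p.2)))) F,
          fun t => ?_⟩
        simp only [hF]
        rw [← Polynomial.coe_evalRingHom, MvPolynomial.aeval_def, MvPolynomial.hom_eval₂,
          ← MvPolynomial.eval₂_id]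
        congr 1
        · ext1 x; simp
        · ext i
          rcases i with i | i
          · simp
          · simp; ring) (by
        intro g hg v A hA
        have := hinv (g.submatrix ψ ψ) (by rw [Matrix.det_submatrix_equiv_self, hg]) (v ∘ ψ)
          (A.submatrix ψ ψ) (by rw [Matrix.transpose_submatrix, hA]; rfl)
        show f ((g *ᵥ v) ∘ ψ) _ = _
        rw [← this, sub_conj']
        congr 1
        ext i
        simp [Matrix.submatrix_mulVec_equiv, ψ, Function.comp_def])
    refine ⟨Q, fun v A hA => ?_⟩
    have := hQ (v ∘ phiEquiv e) (A.submatrix (phiEquiv e) (phiEquiv e))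
      (by rw [Matrix.transpose_submatrix, hA]; rfl)
    rw [pfafP_eq, ← this]
    simp only [ψ, Function.comp_def, Matrix.submatrix_submatrix, Equiv.apply_symm_apply]
    rfl
  · refine ⟨(JJ e).submatrix (phiEquiv e).symm (phiEquiv e).symm, 0, ?_, by simp, ?_⟩
    · rw [Matrix.transpose_submatrix, JJ_transpose]; rfl
    · rw [pfafP_eq, pfafP_eq, Matrix.submatrix_submatrix]
      simp only [Equiv.symm_comp_self, Matrix.submatrix_id_id]
      have : pf2 e ((0 : Matrix (Fin (2 * e)) (Fin (2 * e)) ℂ).submatrix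
          (phiEquiv e) (phiEquiv e)) = 0 := by
        unfold pf2
        refine Finset.sum_eq_zero fun σ _ => ?_
        rw [Finset.prod_eq_zero (Finset.mem_univ (⟨0, by omega⟩ : Fin e)) (by simp), mul_zero]
      rw [this]
      exact pf2_JJ e
end

section
/- Let d = 2e + 1 be odd. Define the polynomial q(v, A) = Σ_{σ ∈ S_d} sgn(σ) · v_{σ(1)} · Π_{i=1}^{e} A_{σ(2i),σ(2i+1)} on pairs (v, A) ∈ ℂ^d × {skew-symmetric d×d complex matrices}. Then (i) q is SL_d(ℂ)-invariant: q(g v, g A gᵀ) = q(v, A) for all g ∈ SL_d(ℂ); and (ii) every polynomial function f(v, A) satisfying f(g v, g A gᵀ) = f(v, A) for all g ∈ SL_d(ℂ) is a polynomial in q(v, A) alone; moreover q is non-constant, so this invariant ring is a univariate polynomial ring generated by q. -/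
open Matrix

/-- The odd-dimensional alternating-signature polynomial
`q(v, A) = Σ_{σ ∈ S_d} sgn(σ) · v_{σ(1)} · Π_{i=1}^{e} A_{σ(2i), σ(2i+1)}`
(written with `0`-based indices) where `d = 2e + 1`. -/
noncomputable def qAlt (e : ℕ) (v : Fin (2 * e + 1) → ℂ)
    (A : Matrix (Fin (2 * e + 1)) (Fin (2 * e + 1)) ℂ) : ℂ :=
  ∑ σ : Equiv.Perm (Fin (2 * e + 1)),
    ((Equiv.Perm.sign σ : ℤ) : ℂ) * v (σ ⟨0, by omega⟩) *
      ∏ i : Fin e,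
        A (σ ⟨2 * i.val + 1, by have := i.2; omega⟩) (σ ⟨2 * i.val + 2, by have := i.2; omega⟩)

/-- Index splitting `{0} ∪ pairs`. -/
def idxE (e : ℕ) : Fin (2 * e + 1) ≃ Option (Fin e × Fin 2) :=
  (finSuccEquiv (2 * e)).trans
    (Equiv.optionCongr ((finCongr (mul_comm 2 e)).trans finProdFinEquiv.symm))

lemma idxE_symm_none (e : ℕ) : (idxE e).symm none = ⟨0, by omega⟩ := by
  simp [idxE]
  rfl

lemma idxE_symm_zero (e : ℕ) (i : Fin e) :
    (idxE e).symm (some (i, 0)) = ⟨2 * i.val + 1, by have := i.2; omega⟩ := by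
  change Fin.succ _ = _
  simp [finProdFinEquiv, Fin.ext_iff]

lemma idxE_symm_one (e : ℕ) (i : Fin e) :
    (idxE e).symm (some (i, 1)) = ⟨2 * i.val + 2, by have := i.2; omega⟩ := by
  change Fin.succ _ = _
  simp [finProdFinEquiv, Fin.ext_iff]
  omega

lemma qAlt_eq (e : ℕ) (v : Fin (2 * e + 1) → ℂ)
    (A : Matrix (Fin (2 * e + 1)) (Fin (2 * e + 1)) ℂ) :
    qAlt e v A = ∑ σ : Equiv.Perm (Fin (2 * e + 1)),
      ((Equiv.Perm.sign σ : ℤ) : ℂ) * v (σ ((idxE e).symm none)) *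
      ∏ i : Fin e, A (σ ((idxE e).symm (some (i, 0)))) (σ ((idxE e).symm (some (i, 1)))) := by
  simp only [idxE_symm_none, idxE_symm_zero, idxE_symm_one]
  rfl

lemma prod_idx {e : ℕ} (h : Fin (2 * e + 1) → ℂ) :
    ∏ j, h j = h ((idxE e).symm none) *
      ∏ i : Fin e, (h ((idxE e).symm (some (i, 0))) * h ((idxE e).symm (some (i, 1)))) := by
  rw [← Equiv.prod_comp (idxE e).symm h, Fintype.prod_option, Fintype.prod_prod_type]
  simp [Fin.prod_univ_two]

lemma sum_idx {e : ℕ} (h : Fin (2 * e + 1) → ℂ) :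
    ∑ j, h j = h ((idxE e).symm none) +
      ∑ i : Fin e, (h ((idxE e).symm (some (i, 0))) + h ((idxE e).symm (some (i, 1)))) := by
  rw [← Equiv.sum_comp (idxE e).symm h, Fintype.sum_option, Fintype.sum_prod_type]
  simp [Fin.sum_univ_two]

/-- Column selection. -/
def colSel (e : ℕ) (k : Fin (2 * e + 1)) (p : Fin e → Fin (2 * e + 1) × Fin (2 * e + 1)) :
    Fin (2 * e + 1) → Fin (2 * e + 1) := fun j =>
  match idxE e j with
  | none => k
  | some (i, 0) => (p i).1
  | some (i, 1) => (p i).2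

lemma qAlt_expand (e : ℕ) (g : Matrix (Fin (2 * e + 1)) (Fin (2 * e + 1)) ℂ)
    (v : Fin (2 * e + 1) → ℂ) (A : Matrix (Fin (2 * e + 1)) (Fin (2 * e + 1)) ℂ) :
    qAlt e (g.mulVec v) (g * A * gᵀ) =
      ∑ k, ∑ p : Fin e → Fin (2 * e + 1) × Fin (2 * e + 1),
        (v k * ∏ i, A (p i).1 (p i).2) * (g.submatrix id (colSel e k p)).det := by
  have hA : ∀ x y, (g * A * gᵀ) x y =
      ∑ p : Fin (2 * e + 1) × Fin (2 * e + 1), g x p.1 * A p.1 p.2 * g y p.2 := by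
    intro x y
    rw [Matrix.mul_apply, Fintype.sum_prod_type, Finset.sum_comm]
    refine Finset.sum_congr rfl fun l _ => ?_
    rw [Matrix.mul_apply, Finset.sum_mul]
    rfl
  have key : ∀ σ : Equiv.Perm (Fin (2 * e + 1)),
      ((Equiv.Perm.sign σ : ℤ) : ℂ) * (g.mulVec v) (σ ((idxE e).symm none)) *
      ∏ i : Fin e, (g * A * gᵀ) (σ ((idxE e).symm (some (i, 0))))
        (σ ((idxE e).symm (some (i, 1)))) =
      ∑ k, ∑ p : Fin e → Fin (2 * e + 1) × Fin (2 * e + 1),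
        (v k * ∏ i, A (p i).1 (p i).2) *
          (((Equiv.Perm.sign σ : ℤ) : ℂ) * ∏ j, g (σ j) (colSel e k p j)) := by
    intro σ
    simp only [hA, Finset.prod_univ_sum, Fintype.piFinset_univ]
    simp only [Matrix.mulVec, dotProduct]
    rw [mul_assoc, Finset.sum_mul_sum, Finset.mul_sum]
    refine Finset.sum_congr rfl fun k _ => ?_
    rw [Finset.mul_sum]
    refine Finset.sum_congr rfl fun p _ => ?_
    rw [prod_idx]
    simp only [colSel, Equiv.apply_symm_apply, Finset.prod_mul_distrib]
    ring
  rw [qAlt_eq, Finset.sum_congr rfl fun σ _ => key σ, Finset.sum_comm]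
  refine Finset.sum_congr rfl fun k _ => ?_
  rw [Finset.sum_comm]
  refine Finset.sum_congr rfl fun p _ => ?_
  rw [Matrix.det_apply', Finset.mul_sum]
  rfl

lemma qAlt_cov (e : ℕ) (g : Matrix (Fin (2 * e + 1)) (Fin (2 * e + 1)) ℂ)
    (v : Fin (2 * e + 1) → ℂ) (A : Matrix (Fin (2 * e + 1)) (Fin (2 * e + 1)) ℂ) :
    qAlt e (g.mulVec v) (g * A * gᵀ) = g.det * qAlt e v A := by
  have h1 := qAlt_expand e 1 v A
  simp only [Matrix.one_mulVec, Matrix.one_mul, Matrix.transpose_one, Matrix.mul_one] at h1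
  rw [qAlt_expand, h1, Finset.mul_sum]
  refine Finset.sum_congr rfl fun k _ => ?_
  rw [Finset.mul_sum]
  refine Finset.sum_congr rfl fun p _ => ?_
  have : g.submatrix id (colSel e k p) =
      g * (1 : Matrix (Fin (2 * e + 1)) (Fin (2 * e + 1)) ℂ).submatrix id (colSel e k p) := by
    ext x y
    simp [Matrix.mul_apply, Matrix.one_apply]
  rw [this, Matrix.det_mul]
  ring

/-- Standard skew form on the pair indices. -/
def stdB (e : ℕ) : Option (Fin e × Fin 2) → Option (Fin e × Fin 2) → ℂ
  | some (i, 0), some (j, 1) => if i = j then 1 else 0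
  | some (i, 1), some (j, 0) => if i = j then -1 else 0
  | _, _ => 0

/-- Standard skew form. -/
def stdJ (e : ℕ) : Matrix (Fin (2 * e + 1)) (Fin (2 * e + 1)) ℂ :=
  fun x y => stdB e (idxE e x) (idxE e y)

/-- Standard vector. -/
def stdV (e : ℕ) : Fin (2 * e + 1) → ℂ := fun x => if idxE e x = none then 1 else 0

lemma stdB_skew (e : ℕ) (x y) : stdB e x y = - stdB e y x := by
  rcases x with _ | ⟨i, k⟩ <;> rcases y with _ | ⟨j, l⟩ <;> try (simp [stdB])
  fin_cases k <;> fin_cases l <;> simp [stdB, eq_comm] <;> split_ifs <;> simp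

lemma stdJ_skew (e : ℕ) : (stdJ e)ᵀ = - stdJ e := by
  ext x y
  exact stdB_skew e _ _

lemma fin2_perm (e : ℕ) (a b : Fin e × Fin 2) (h : stdB e (some a) (some b) ≠ 0) :
    b.1 = a.1 ∧ ∃ s : Equiv.Perm (Fin 2), s 0 = a.2 ∧ s 1 = b.2 ∧
      stdB e (some a) (some b) = ((Equiv.Perm.sign s : ℤ) : ℂ) := by
  obtain ⟨i, k⟩ := a
  obtain ⟨j, l⟩ := b
  fin_cases k <;> fin_cases l <;> simp [stdB] at h ⊢
  · refine ⟨h.symm, 1, ?_⟩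
    simp [h]
  · refine ⟨h.symm, Equiv.swap 0 1, ?_⟩
    simp [h]

lemma pair_sign (e : ℕ) (τ : Equiv.Perm (Fin e × Fin 2))
    (h : ∀ i, stdB e (some (τ (i, 0))) (some (τ (i, 1))) ≠ 0) :
    ((Equiv.Perm.sign τ : ℤ) : ℂ) * ∏ i, stdB e (some (τ (i, 0))) (some (τ (i, 1))) = 1 := by
  choose h1 s hs0 hs1 hs using fun i => fin2_perm e _ _ (h i)
  have hinj : Function.Injective fun i => (τ (i, 0)).1 := by
    have : Function.Surjective fun i => (τ (i, 0)).1 := by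
      intro j
      obtain ⟨⟨i, k⟩, hik⟩ := τ.surjective (j, 0)
      refine ⟨i, ?_⟩
      fin_cases k
      · simp at hik; simp [hik]
      · simp at hik; simp [← h1, hik]
    exact Finite.injective_iff_surjective.mpr this
  let π : Equiv.Perm (Fin e) := Equiv.ofBijective _ (Finite.injective_iff_bijective.mp hinj)
  have hτ : τ = Equiv.prodCongrLeft (fun _ : Fin 2 => π) * Equiv.prodCongrRight s := by
    ext1 ⟨i, k⟩
    fin_cases k
    · simp [π, hs0, Equiv.prodCongrLeft, Equiv.prodCongrRight]
    · simp [π, hs1, Equiv.prodCongrLeft, Equiv.prodCongrRight, ← h1]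
  have hsg : Equiv.Perm.sign τ = ∏ i, Equiv.Perm.sign (s i) := by
    rw [hτ, Equiv.Perm.sign_mul, Equiv.Perm.sign_prodCongrLeft, Equiv.Perm.sign_prodCongrRight]
    simp
  simp only [hs, hsg]
  push_cast
  rw [← Finset.prod_mul_distrib]
  refine Finset.prod_eq_one fun i _ => ?_
  rcases Int.units_eq_one_or (Equiv.Perm.sign (s i)) with h | h <;> simp [h]

lemma std_term (e : ℕ) (σ : Equiv.Perm (Fin (2 * e + 1))) :
    ∃ n : ℕ, ((Equiv.Perm.sign σ : ℤ) : ℂ) * stdV e (σ ((idxE e).symm none)) *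
      ∏ i : Fin e, stdJ e (σ ((idxE e).symm (some (i, 0)))) (σ ((idxE e).symm (some (i, 1)))) 
      = n := by
  by_cases h0 : stdV e (σ ((idxE e).symm none)) = 0
  · exact ⟨0, by simp [h0]⟩
  by_cases h1 : ∃ i, stdJ e (σ ((idxE e).symm (some (i, 0))))
      (σ ((idxE e).symm (some (i, 1)))) = 0
  · obtain ⟨i, hi⟩ := h1
    exact ⟨0, by rw [Finset.prod_eq_zero (Finset.mem_univ i) hi]; simp⟩
  push Not at h1
  have h0' : idxE e (σ ((idxE e).symm none)) = none := by
    by_contra hne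
    exact h0 (by simp [stdV, hne])
  let ρ : Equiv.Perm (Option (Fin e × Fin 2)) := (idxE e).permCongr σ
  have hρ0 : ρ none = none := by simpa [ρ] using h0'
  have hρ : ρ = Equiv.optionCongr (Equiv.removeNone ρ) := by
    rw [map_equiv_removeNone, hρ0]
    simp
    rfl
  have hs : Equiv.Perm.sign σ = Equiv.Perm.sign (Equiv.removeNone ρ) := by
    rw [← Equiv.optionCongr_sign (Equiv.removeNone ρ), ← hρ, Equiv.Perm.sign_permCongr]
  have hJ : ∀ a b, stdJ e (σ ((idxE e).symm (some a))) (σ ((idxE e).symm (some b)))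
      = stdB e (some (Equiv.removeNone ρ a)) (some (Equiv.removeNone ρ b)) := by
    intro a b
    have h2 : ∀ a, idxE e (σ ((idxE e).symm (some a))) = some (Equiv.removeNone ρ a) := by
      intro a
      have : ρ (some a) = some (Equiv.removeNone ρ a) := by
        have h3 := congrArg (fun r : Equiv.Perm (Option (Fin e × Fin 2)) => r (some a)) hρ
        simpa only [Equiv.optionCongr_apply, Option.map_some] using h3
      rw [← this]
      simp [ρ]
    simp only [stdJ, h2]
  refine ⟨1, ?_⟩
  have hv : stdV e (σ ((idxE e).symm none)) = 1 := by simp [stdV, h0']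
  simp only [hJ] at h1 ⊢
  rw [hv, hs, mul_one, pair_sign e _ h1]
  simp

lemma std_ne (e : ℕ) : qAlt e (stdV e) (stdJ e) ≠ 0 := by
  rw [qAlt_eq]
  choose n hn using std_term e
  have h1 : n 1 = 1 := by
    have := hn 1
    simp [stdV, stdJ, stdB] at this
    exact_mod_cast this.symm
  simp only [hn]
  rw [← Nat.cast_sum]
  have : n 1 ≤ ∑ σ, n σ := Finset.single_le_sum (fun _ _ => Nat.zero_le _) (Finset.mem_univ _)
  exact_mod_cast (by omega : (∑ σ, n σ) ≠ 0)

lemma skew_decomp {d : ℕ} (k : ℕ) : ∀ (S : Finset (Fin d)) (A : Matrix (Fin d) (Fin d) ℂ),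
    Aᵀ = -A → S.card ≤ 2 * k + 1 → (∀ i j, A i j ≠ 0 → i ∈ S) →
    ∃ x y : Fin k → Fin d → ℂ, ∀ i j, A i j = ∑ m, (x m i * y m j - y m i * x m j) := by
  induction k with
  | zero =>
    intro S A hA hS hsup
    refine ⟨fun _ _ => 0, fun _ _ => 0, fun i j => ?_⟩
    have hsk : ∀ i j, A j i = - A i j := fun i j => congrFun (congrFun hA i) j
    by_contra hne
    have hne' : A i j ≠ 0 := by simpa using hne
    have hi := hsup i j hne'
    have hj := hsup j i (by rw [hsk]; simpa using hne')
    have := Finset.card_le_one.mp (by simpa using hS) i hi j hj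
    subst this
    have := hsk i i
    exact hne' (self_eq_neg.mp this)
  | succ k ih =>
    intro S A hA hS hsup
    have hsk : ∀ i j, A j i = - A i j := fun i j => congrFun (congrFun hA i) j
    have hd : ∀ i, A i i = 0 := fun i => self_eq_neg.mp (hsk i i)
    by_cases h0 : ∃ a b, A a b ≠ 0
    · obtain ⟨a, b, hab⟩ := h0
      have hne : a ≠ b := by rintro rfl; exact hab (hd a)
      have ha := hsup a b hab
      have hb := hsup b a (by rw [hsk]; simpa using hab)
      obtain ⟨x, y, hxy⟩ : ∃ x y : Fin k → Fin d → ℂ, ∀ i j,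
          (Matrix.of fun i j => A i j - (A i b * A a j - A a i * A j b) / A a b) i j
            = ∑ m, (x m i * y m j - y m i * x m j) := by
        refine ih ((S.erase a).erase b) _ ?_ ?_ ?_
        · ext i j
          simp only [Matrix.transpose_apply, Matrix.of_apply, Matrix.neg_apply]
          rw [hsk i j]
          ring
        · rw [Finset.card_erase_of_mem (by simp [hb, hne.symm]), Finset.card_erase_of_mem ha]
          omega
        · intro i j hij
          simp only [Matrix.of_apply] at hij
          have hia : i ≠ a := by
            rintro rfl
            apply hij
            rw [hd]
            field_simp
            ring
          have hib : i ≠ b := by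
            rintro rfl
            apply hij
            rw [hd, hsk i j]
            field_simp
            ring
          simp only [Finset.mem_erase]
          refine ⟨hib, hia, ?_⟩
          by_contra hiS
          have hz : ∀ j, A i j = 0 := fun j => by
            by_contra h
            exact hiS (hsup i j h)
          apply hij
          rw [hz, hz, hsk i a, hz]
          simp
      refine ⟨Fin.cons (fun i => A i b / A a b) x, Fin.cons (fun j => A a j) y, fun i j => ?_⟩
      rw [Fin.sum_univ_succ]
      simp only [Fin.cons_zero, Fin.cons_succ]
      rw [← hxy]
      simp only [Matrix.of_apply]
      field_simp
      ring
    · push Not at h0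
      exact ⟨fun _ _ => 0, fun _ _ => 0, fun i j => by simp [h0]⟩

lemma exists_g (e : ℕ) (v : Fin (2 * e + 1) → ℂ)
    (A : Matrix (Fin (2 * e + 1)) (Fin (2 * e + 1)) ℂ) (hA : Aᵀ = -A) :
    ∃ g : Matrix (Fin (2 * e + 1)) (Fin (2 * e + 1)) ℂ,
      g.mulVec (stdV e) = v ∧ g * stdJ e * gᵀ = A := by
  obtain ⟨x, y, hxy⟩ := skew_decomp e Finset.univ A hA (by simp) (by simp)
  let G : Fin (2 * e + 1) → Option (Fin e × Fin 2) → ℂ := fun a j =>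
    match j with
    | none => v a
    | some (i, 0) => x i a
    | some (i, 1) => y i a
  refine ⟨Matrix.of fun a j => G a (idxE e j), ?_, ?_⟩
  · ext a
    simp only [Matrix.mulVec, dotProduct]
    rw [sum_idx]
    simp [stdV, G]
  · ext a b
    rw [Matrix.mul_apply, hxy, sum_idx]
    simp only [Matrix.mul_apply, sum_idx, Matrix.transpose_apply]
    simp [stdJ, stdB, G]
    rw [← Finset.sum_sub_distrib]
    refine Finset.sum_congr rfl fun i _ => ?_
    ring

lemma exists_sl (e : ℕ) (v : Fin (2 * e + 1) → ℂ)
    (A : Matrix (Fin (2 * e + 1)) (Fin (2 * e + 1)) ℂ) (hA : Aᵀ = -A) (hq : qAlt e v A ≠ 0) :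
    ∃ g : Matrix (Fin (2 * e + 1)) (Fin (2 * e + 1)) ℂ, g.det = 1 ∧
      g.mulVec ((qAlt e v A / qAlt e (stdV e) (stdJ e)) • stdV e) = v ∧ g * stdJ e * gᵀ = A := by
  obtain ⟨g, hv, hJ⟩ := exists_g e v A hA
  have hc := std_ne e
  have hdet := qAlt_cov e g (stdV e) (stdJ e)
  rw [hv, hJ] at hdet
  have hg : g.det ≠ 0 := by
    intro h
    rw [h, zero_mul] at hdet
    exact hq hdet
  have hquot : qAlt e v A / qAlt e (stdV e) (stdJ e) = g.det := by
    rw [hdet]; field_simp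
  rw [hquot]
  let D : Fin (2 * e + 1) → ℂ := fun j => if idxE e j = none then g.det⁻¹ else 1
  refine ⟨g * Matrix.diagonal D, ?_, ?_, ?_⟩
  · rw [Matrix.det_mul, Matrix.det_diagonal, prod_idx]
    simp [D, hg]
  · rw [← Matrix.mulVec_mulVec]
    have : (Matrix.diagonal D).mulVec (g.det • stdV e) = stdV e := by
      ext j
      simp only [Matrix.mulVec_diagonal, D, stdV, Pi.smul_apply, smul_eq_mul]
      split_ifs <;> simp [hg]
    rw [this, hv]
  · have : Matrix.diagonal D * stdJ e * Matrix.diagonal D = stdJ e := by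
      ext a b
      simp only [Matrix.mul_diagonal, Matrix.diagonal_mul, D, stdJ]
      rcases idxE e a with _ | a <;> rcases idxE e b with _ | b <;> simp [stdB]
    rw [Matrix.transpose_mul, Matrix.diagonal_transpose]
    calc _ = g * (Matrix.diagonal D * stdJ e * Matrix.diagonal D) * gᵀ := by
          simp only [Matrix.mul_assoc]
      _ = A := by rw [this, hJ]

lemma eval_aeval_poly {τ : Type*} (F : MvPolynomial τ ℂ) (p : τ → Polynomial ℂ) (x : ℂ) :
    (MvPolynomial.aeval p F).eval x = MvPolynomial.eval (fun i => (p i).eval x) F := by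
  induction F using MvPolynomial.induction_on with
  | C a => simp
  | add p q hp hq => simp [hp, hq]
  | mul_X p i hp => simp [hp]

/-- For `d = 2e + 1` odd:
(i) `q` is `SL_d(ℂ)`-invariant on pairs of a vector and a skew-symmetric matrix;
(ii) every polynomial function `f(v, A)` invariant under the `SL_d(ℂ)`-action
`g·(v,A) = (gv, gAgᵀ)` is a polynomial in `q(v, A)` alone; and
(iii) `q` is non-constant, so the invariant ring is a univariate polynomial
ring generated by `q`. -/
theorem qAlt_generates_invariants (e : ℕ) :
    (∀ g : Matrix (Fin (2 * e + 1)) (Fin (2 * e + 1)) ℂ, g.det = 1 →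
      ∀ (v : Fin (2 * e + 1) → ℂ) (A : Matrix (Fin (2 * e + 1)) (Fin (2 * e + 1)) ℂ), Aᵀ = -A →
        qAlt e (g.mulVec v) (g * A * gᵀ) = qAlt e v A) ∧
    (∀ f : (Fin (2 * e + 1) → ℂ) → Matrix (Fin (2 * e + 1)) (Fin (2 * e + 1)) ℂ → ℂ,
      (∃ F : MvPolynomial (Fin (2 * e + 1) ⊕ Fin (2 * e + 1) × Fin (2 * e + 1)) ℂ,
        ∀ v A, f v A = MvPolynomial.eval (Sum.elim v fun p => A p.1 p.2) F) →
      (∀ g : Matrix (Fin (2 * e + 1)) (Fin (2 * e + 1)) ℂ, g.det = 1 →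
        ∀ (v : Fin (2 * e + 1) → ℂ) (A : Matrix (Fin (2 * e + 1)) (Fin (2 * e + 1)) ℂ), Aᵀ = -A →
          f (g.mulVec v) (g * A * gᵀ) = f v A) →
      ∃ Q : Polynomial ℂ, ∀ (v : Fin (2 * e + 1) → ℂ)
          (A : Matrix (Fin (2 * e + 1)) (Fin (2 * e + 1)) ℂ), Aᵀ = -A →
        f v A = Q.eval (qAlt e v A)) ∧
    (∃ (v w : Fin (2 * e + 1) → ℂ)
        (A B : Matrix (Fin (2 * e + 1)) (Fin (2 * e + 1)) ℂ),
      Aᵀ = -A ∧ Bᵀ = -B ∧ qAlt e v A ≠ qAlt e w B) := by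
  refine ⟨fun g hg v A _ => by rw [qAlt_cov, hg, one_mul], ?_, ?_⟩
  · rintro f ⟨F, hF⟩ hinv
    set c := qAlt e (stdV e) (stdJ e) with hc
    have hc0 : c ≠ 0 := std_ne e
    let Q : Polynomial ℂ := MvPolynomial.aeval
      (Sum.elim (fun j => Polynomial.C (stdV e j / c) * Polynomial.X)
        (fun p => Polynomial.C (stdJ e p.1 p.2))) F
    have hQ : ∀ x, Q.eval x = f ((x / c) • stdV e) (stdJ e) := by
      intro x
      rw [hF, eval_aeval_poly]
      congr 2
      ext i
      rcases i with i | i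
      · simp
        ring
      · simp
    have hgen : ∀ v A, Aᵀ = -A → qAlt e v A ≠ 0 → f v A = Q.eval (qAlt e v A) := by
      intro v A hA hq
      obtain ⟨g, hg, hv, hJ⟩ := exists_sl e v A hA hq
      rw [hQ, ← hinv g hg _ _ (stdJ_skew e), hv, hJ]
    refine ⟨Q, fun v A hA => ?_⟩
    let lv : Fin (2 * e + 1) → Polynomial ℂ := fun j =>
      Polynomial.C (v j) + Polynomial.X * Polynomial.C (stdV e j - v j)
    let lA : Fin (2 * e + 1) → Fin (2 * e + 1) → Polynomial ℂ := fun i j =>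
      Polynomial.C (A i j) + Polynomial.X * Polynomial.C (stdJ e i j - A i j)
    let V : ℂ → Fin (2 * e + 1) → ℂ := fun t j => (lv j).eval t
    let M : ℂ → Matrix (Fin (2 * e + 1)) (Fin (2 * e + 1)) ℂ := fun t i j => (lA i j).eval t
    have hV0 : V 0 = v := by ext j; simp [V, lv]
    have hV1 : V 1 = stdV e := by ext j; simp [V, lv]
    have hM0 : M 0 = A := by ext i j; simp [M, lA]
    have hM1 : M 1 = stdJ e := by ext i j; simp [M, lA]
    have hMs : ∀ t, (M t)ᵀ = - M t := by
      intro t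
      ext i j
      have h1 : A j i = - A i j := congrFun (congrFun hA i) j
      have h2 : stdJ e j i = - stdJ e i j := congrFun (congrFun (stdJ_skew e) i) j
      change (lA j i).eval t = -(lA i j).eval t
      simp only [lA, h1, h2, Polynomial.eval_add, Polynomial.eval_mul, Polynomial.eval_C,
        Polynomial.eval_X]
      ring
    let fp : Polynomial ℂ := MvPolynomial.aeval (Sum.elim lv (fun p => lA p.1 p.2)) F
    have hfp : ∀ t, fp.eval t = f (V t) (M t) := by
      intro t
      rw [hF, eval_aeval_poly]
      congr 2
      ext i
      rcases i with i | i <;> simp [V, M]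
    let qp : Polynomial ℂ := ∑ σ : Equiv.Perm (Fin (2 * e + 1)),
      Polynomial.C ((Equiv.Perm.sign σ : ℤ) : ℂ) * lv (σ ((idxE e).symm none)) *
      ∏ i : Fin e, lA (σ ((idxE e).symm (some (i, 0)))) (σ ((idxE e).symm (some (i, 1))))
    have hqp : ∀ t, qp.eval t = qAlt e (V t) (M t) := by
      intro t
      rw [qAlt_eq]
      simp only [qp, V, M, Polynomial.eval_finsetSum, Polynomial.eval_mul, Polynomial.eval_prod,
        Polynomial.eval_C]
    have hprod : (fp - Q.comp qp) * qp = 0 := by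
      apply Polynomial.funext
      intro t
      rw [Polynomial.eval_mul, Polynomial.eval_sub, Polynomial.eval_comp, hfp, hqp,
        Polynomial.eval_zero]
      by_cases h : qAlt e (V t) (M t) = 0
      · rw [h, mul_zero]
      · rw [hgen _ _ (hMs t) h, sub_self, zero_mul]
    have hqp0 : qp ≠ 0 := by
      intro h
      have := hqp 1
      rw [h, hV1, hM1, Polynomial.eval_zero] at this
      exact hc0 this.symm
    have hz := (mul_eq_zero.mp hprod).resolve_right hqp0
    have h0 := congrArg (Polynomial.eval 0) hz
    rw [Polynomial.eval_sub, Polynomial.eval_comp, hfp, hqp, hV0, hM0, Polynomial.eval_zero] at h0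
    exact sub_eq_zero.mp h0
  · refine ⟨stdV e, 0, stdJ e, stdJ e, stdJ_skew e, stdJ_skew e, ?_⟩
    have : qAlt e 0 (stdJ e) = 0 := by simp [qAlt]
    rw [this]
    exact std_ne e
end
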